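/- arXiv:2303.01969 — 3 statements merged into one kernel-verified Lean document; each statement's English description precedes it below -/
import Mathlib

section
/- Let X be a maximal 1-separated subset of the hyperbolic plane ℍ². Then asdim_{poly(2)}(X) = 1; that is: (upper bound) for every r > 0 there exist a constant C and a decomposition X = X₀ ∪ X₁ in which each X_i is a disjoint union of subsets ('pieces') any two of which are at distance ≥ r, with |U ∩ B(x, s)| ≤ C·s² + C for every piece U, every x, and every s ≥ 0; and (lower bound) there exists r > 0 for which no such decomposition with a single colour X = X₀ exists. -/
open Metric Set

/-- A metric space is 1-uniformly discrete. -/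
def UnifDiscrete (X : Type*) [MetricSpace X] : Prop :=
  ∀ x y : X, x ≠ y → 1 ≤ dist x y

/-- Bounded geometry: balls of each radius have uniformly bounded cardinality. -/
def BddGeom (X : Type*) [MetricSpace X] : Prop :=
  ∀ R : ℝ, ∃ N : ℕ, ∀ (x : X) (s : Finset X), ↑s ⊆ Metric.closedBall x R → s.card ≤ N

/-- A regular map between metric spaces. -/
def IsRegularMap {X Y : Type*} [MetricSpace X] [MetricSpace Y] (f : X → Y) : Prop :=
  ∃ κ : ℕ, 1 ≤ κ ∧ (∀ x x' : X, dist (f x) (f x') ≤ κ * (1 + dist x x')) ∧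
    ∀ y : Y, ∃ c : Finset X, c.card ≤ κ ∧ f ⁻¹' Metric.ball y 1 ⊆ ⋃ x ∈ c, Metric.ball x 1

/-- A quasi-isometric embedding. -/
def IsQIEmbedding {X Y : Type*} [MetricSpace X] [MetricSpace Y] (f : X → Y) : Prop :=
  ∃ L D : ℝ, 1 ≤ L ∧ 0 ≤ D ∧ ∀ x x' : X,
    L⁻¹ * dist x x' - D ≤ dist (f x) (f x') ∧ dist (f x) (f x') ≤ L * dist x x' + D

/-- A coarse Lipschitz map. -/
def CoarseLipschitz {X Y : Type*} [MetricSpace X] [MetricSpace Y] (f : X → Y) : Prop :=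
  ∃ K : ℝ, 1 ≤ K ∧ ∀ x x' : X, dist (f x) (f x') ≤ K * dist x x' + K

/-- The metric of `T` is the graph metric of a 3-regular tree. -/
def IsCubicTreeMetric (T : Type*) [MetricSpace T] : Prop :=
  ∃ G : SimpleGraph T, G.Connected ∧ G.IsAcyclic ∧
    (∀ v : T, (G.neighborSet v).ncard = 3) ∧
    ∀ u v : T, dist u v = (G.dist u v : ℝ)

/-- The metric of `Z` is the graph metric of a connected graph of uniformly bounded degree. -/
def IsBddDegGraphMetric (Z : Type*) [MetricSpace Z] : Prop :=
  ∃ G : SimpleGraph Z, G.Connected ∧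
    (∃ D : ℕ, ∀ v : Z, (G.neighborSet v).ncard ≤ D) ∧
    ∀ u v : Z, dist u v = (G.dist u v : ℝ)

/-- A non-decreasing subexponential function `[0,∞) → [0,∞)`. -/
def SubexpFun (g : ℝ → ℝ) : Prop :=
  MonotoneOn g (Set.Ici 0) ∧ (∀ r : ℝ, 0 ≤ g r) ∧
    Filter.Tendsto (fun r => Real.log (g r) / r) Filter.atTop (nhds 0)

/-- Every ball of radius `r` in `Z` contains at most `g r` points. -/
def HasGrowthBound (Z : Type*) [MetricSpace Z] (g : ℝ → ℝ) : Prop :=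
  ∀ (z : Z) (r : ℝ), 0 ≤ r → ∀ s : Finset Z, ↑s ⊆ Metric.closedBall z r → (s.card : ℝ) ≤ g r

def HasSubexpGrowth (Z : Type*) [MetricSpace Z] : Prop :=
  ∃ g : ℝ → ℝ, SubexpFun g ∧ HasGrowthBound Z g

def HasPolyGrowth (Z : Type*) [MetricSpace Z] : Prop :=
  ∃ (C : ℝ) (d : ℕ), 1 ≤ C ∧ HasGrowthBound Z (fun r => C * r ^ d + C)

/-- Distinct members of the family are at distance at least `r` from each other. -/
def SepFamily {X : Type*} [MetricSpace X] (r : ℝ) (𝒰 : Set (Set X)) : Prop :=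
  ∀ U ∈ 𝒰, ∀ V ∈ 𝒰, U ≠ V → ∀ x ∈ U, ∀ y ∈ V, r ≤ dist x y

/-- A decomposition of `X` into `n+1` colours of `r`-separated pieces. -/
def Decomp {X : Type*} [MetricSpace X] (n : ℕ) (r : ℝ) (𝒰 : Fin (n+1) → Set (Set X)) : Prop :=
  (∀ x : X, ∃ i, ∃ U ∈ 𝒰 i, x ∈ U) ∧ ∀ i, SepFamily r (𝒰 i)

/-- A collection of subsets of `X` has growth uniformly controlled by the family `F`. -/
def FGrowing {X : Type*} [MetricSpace X] (F : Set (ℝ → ℝ)) (𝒰 : Set (Set X)) : Prop :=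
  ∃ f ∈ F, ∃ C : ℝ, 1 ≤ C ∧ ∀ U ∈ 𝒰, ∀ (x : X) (r : ℝ), 0 ≤ r →
    ∀ s : Finset X, ↑s ⊆ U ∩ Metric.closedBall x r → (s.card : ℝ) ≤ C * f (C * r) + C

/-- `asdim_F X ≤ n`. -/
def AsdimLE (F : Set (ℝ → ℝ)) (X : Type*) [MetricSpace X] (n : ℕ) : Prop :=
  ∀ r : ℝ, 0 < r → ∃ 𝒰 : Fin (n+1) → Set (Set X),
    Decomp n r 𝒰 ∧ FGrowing F (⋃ i, 𝒰 i)

/-- Iterated neighbourhoods `N^m_s(Y)` of `Y` with respect to the collection `𝒴`. -/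
def iterNbhd {X : Type*} [MetricSpace X] (𝒴 : Set (Set X)) (s : ℝ) : ℕ → Set X → Set X
  | 0, Y => Y
  | m + 1, Y => ⋃₀ {Y' | Y' ∈ 𝒴 ∧ ∃ x ∈ Y', ∃ z ∈ iterNbhd 𝒴 s m Y, dist x z ≤ s}

/-- `ov-asdim_F X ≤ n`. -/
def OvAsdimLE (F : Set (ℝ → ℝ)) (X : Type*) [MetricSpace X] (n : ℕ) : Prop :=
  ∀ r : ℝ, 0 < r → ∃ 𝒰 : Fin (n+1) → Set (Set X),
    Decomp n r 𝒰 ∧ ∀ s : ℝ, 1 ≤ s → ∀ m : ℕ,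
      FGrowing F ((iterNbhd (⋃ i, 𝒰 i) s m) '' (⋃ i, 𝒰 i))

/-- A family of non-decreasing functions `[0,∞) → [0,∞)`. -/
def NondecrFamily (F : Set (ℝ → ℝ)) : Prop :=
  ∀ f ∈ F, MonotoneOn f (Set.Ici 0) ∧ ∀ r : ℝ, 0 ≤ r → 0 ≤ f r

/-- The family of non-decreasing subexponential functions. -/
def seFamily : Set (ℝ → ℝ) := {g | SubexpFun g}

/-- The family of non-decreasing functions bounded by `C·r^d + C`. -/
def polyFamily (d : ℕ) : Set (ℝ → ℝ) :=
  {f | MonotoneOn f (Set.Ici 0) ∧ (∀ r : ℝ, 0 ≤ f r) ∧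
    ∃ C : ℝ, 0 < C ∧ ∀ r : ℝ, 0 ≤ r → f r ≤ C * r ^ d + C}

/-- `asdim X ≤ n` : classical asymptotic dimension. -/
def ClassicalAsdimLE (X : Type*) [MetricSpace X] (n : ℕ) : Prop :=
  ∀ r : ℝ, 0 < r → ∃ 𝒰 : Fin (n+1) → Set (Set X), Decomp n r 𝒰 ∧
    ∃ B : ℝ, ∀ U ∈ ⋃ i, 𝒰 i, ∀ x ∈ U, ∀ y ∈ U, dist x y ≤ B

/-! ### Signed-digit weights -/

/-- The signed-digit weight of `m` in base `b`: it is unchanged under multiplication by `b`, and an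
integer strictly between `b * k` and `b * (k + 1)` has weight one more than the smaller of the
weights of `k` and `k + 1`. -/
def digitWeight (b m : ℕ) : ℕ :=
  if h : 3 ≤ b ∧ 2 ≤ m then
    have h1 : m / b + 1 < m := by
      have := Nat.div_le_div_left h.1 (by norm_num) (a := m)
      omega
    if b ∣ m then digitWeight b (m / b)
    else 1 + min (digitWeight b (m / b)) (digitWeight b (m / b + 1))
  else m
termination_by m

lemma digitWeight_of_le_one {b m : ℕ} (hm : m ≤ 1) : digitWeight b m = m := by
  rw [digitWeight, dif_neg (by omega)]

lemma digitWeight_mul {b : ℕ} (hb : 3 ≤ b) (m : ℕ) : digitWeight b (b * m) = digitWeight b m := by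
  rcases Nat.eq_zero_or_pos m with rfl | hm
  · simp
  · rw [digitWeight, dif_pos ⟨hb, by nlinarith⟩, if_pos (dvd_mul_right b m),
      Nat.mul_div_cancel_left m (by omega)]

lemma digitWeight_mul_add {b : ℕ} (hb : 3 ≤ b) (k i : ℕ) (hi : 0 < i) (hib : i < b) :
    digitWeight b (b * k + i) = 1 + min (digitWeight b k) (digitWeight b (k + 1)) := by
  rcases Nat.lt_or_ge (b * k + i) 2 with h | h
  · have hk : k = 0 := by
      by_contra hk
      have : b * 1 ≤ b * k := Nat.mul_le_mul_left b (by omega)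
      omega
    subst hk
    have : i = 1 := by omega
    subst this
    simp [digitWeight_of_le_one]
  · have hdiv : (b * k + i) / b = k := by
      rw [Nat.mul_add_div (by omega), Nat.div_eq_of_lt hib, add_zero]
    have hnd : ¬ b ∣ b * k + i := by
      rw [Nat.dvd_add_right (dvd_mul_right b k)]
      exact Nat.not_dvd_of_pos_of_lt hi hib
    rw [digitWeight, dif_pos ⟨hb, h⟩, if_neg hnd, hdiv]

lemma digitWeight_succ {b : ℕ} (hb : 3 ≤ b) (m : ℕ) :
    digitWeight b m ≤ digitWeight b (m + 1) + 1 ∧ digitWeight b (m + 1) ≤ digitWeight b m + 1 := by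
  induction m using Nat.strong_induction_on with
  | _ m ih =>
    rcases Nat.eq_zero_or_pos m with rfl | hm
    · simp [digitWeight_of_le_one]
    · have hlt : m / b < m := Nat.div_lt_self hm (by omega)
      have hq := ih _ hlt
      have hmod := Nat.mod_lt m (show 0 < b by omega)
      have hdm := Nat.div_add_mod m b
      generalize m / b = q at *
      generalize m % b = i at *
      subst hdm
      rcases Nat.eq_zero_or_pos i with rfl | hi
      · rw [add_zero, digitWeight_mul hb, digitWeight_mul_add hb q 1 (by omega) (by omega)]
        omega
      · rw [digitWeight_mul_add hb q i hi hmod]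
        rcases Nat.lt_or_ge (i + 1) b with h | h
        · rw [add_assoc, digitWeight_mul_add hb q (i + 1) (by omega) h]
          omega
        · have : b * q + i + 1 = b * (q + 1) := by rw [mul_add]; omega
          rw [this, digitWeight_mul hb]
          omega

/-- The signed-digit weight of an integer. -/
def intWeight (b : ℕ) (m : ℤ) : ℕ := digitWeight b m.natAbs

lemma intWeight_mul {b : ℕ} (hb : 3 ≤ b) (m : ℤ) : intWeight b (b * m) = intWeight b m := by
  simp [intWeight, Int.natAbs_mul, digitWeight_mul hb]

lemma intWeight_pow_mul {b : ℕ} (hb : 3 ≤ b) (j : ℕ) (m : ℤ) :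
    intWeight b (b ^ j * m) = intWeight b m := by
  induction j with
  | zero => simp
  | succ j ih => rw [pow_succ', mul_assoc, intWeight_mul hb, ih]

lemma intWeight_mul_add {b : ℕ} (hb : 3 ≤ b) (k i : ℤ) (hi : 0 < i) (hib : i < b) :
    intWeight b (b * k + i) = 1 + min (intWeight b k) (intWeight b (k + 1)) := by
  lift i to ℕ using hi.le
  rcases le_or_gt 0 k with hk | hk
  · lift k to ℕ using hk
    have := digitWeight_mul_add hb k i (by omega) (by omega)
    unfold intWeight
    norm_cast
  · obtain ⟨l, rfl⟩ : ∃ l : ℕ, k = -((l : ℤ) + 1) := ⟨(-k - 1).toNat, by omega⟩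
    have h := digitWeight_mul_add hb l (b - i) (by omega) (by omega)
    have e1 : (b * -((l : ℤ) + 1) + i).natAbs = b * l + (b - i) := by
      have : (b * -((l : ℤ) + 1) + i) = -((b * l + (b - i) : ℕ) : ℤ) := by
        push_cast [show i ≤ b by omega]
        ring
      rw [this, Int.natAbs_neg, Int.natAbs_natCast]
    have e2 : (-((l : ℤ) + 1)).natAbs = l + 1 := by omega
    have e3 : (-((l : ℤ) + 1) + 1).natAbs = l := by omega
    rw [intWeight, intWeight, intWeight, e1, e2, e3, h, min_comm]

lemma intWeight_succ {b : ℕ} (hb : 3 ≤ b) (m : ℤ) :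
    intWeight b m ≤ intWeight b (m + 1) + 1 ∧ intWeight b (m + 1) ≤ intWeight b m + 1 := by
  unfold intWeight
  rcases le_or_gt 0 m with hm | hm
  · have e : (m + 1).natAbs = m.natAbs + 1 := by omega
    rw [e]
    exact digitWeight_succ hb _
  · have e : m.natAbs = (m + 1).natAbs + 1 := by omega
    rw [e]
    exact (digitWeight_succ hb _).symm

lemma intWeight_mul_add_bounds {b : ℕ} (hb : 3 ≤ b) (m u : ℤ) (hu : |u| < b) :
    intWeight b m ≤ intWeight b (b * m + u) ∧ intWeight b (b * m + u) ≤ intWeight b m + 1 := by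
  rw [abs_lt] at hu
  rcases lt_trichotomy u 0 with h | rfl | h
  · have e : (b : ℤ) * m + u = b * (m - 1) + (u + b) := by ring
    have h1 := intWeight_succ hb (m - 1)
    rw [e, intWeight_mul_add hb _ _ (by omega) (by omega)]
    rw [sub_add_cancel] at *
    omega
  · simp [intWeight_mul hb]
  · have h1 := intWeight_succ hb m
    rw [intWeight_mul_add hb _ _ h hu.2]
    omega

/-- Between consecutive grid points the weight never drops below the smaller end weight. -/
lemma min_le_intWeight {b : ℕ} (hb : 3 ≤ b) (j : ℕ) (a q : ℤ) (h1 : b ^ j * a ≤ q)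
    (h2 : q ≤ b ^ j * (a + 1)) : min (intWeight b a) (intWeight b (a + 1)) ≤ intWeight b q := by
  induction j generalizing q with
  | zero =>
    simp only [pow_zero, one_mul] at h1 h2
    obtain rfl | rfl : q = a ∨ q = a + 1 := by omega
    · exact min_le_left _ _
    · exact min_le_right _ _
  | succ j ih =>
    have hb0 : (0 : ℤ) < b := by omega
    have hdm := Int.mul_ediv_add_emod q b
    have hn := Int.emod_nonneg q hb0.ne'
    have hlt := Int.emod_lt_of_pos q hb0
    generalize q / (b : ℤ) = p at *
    generalize q % (b : ℤ) = i at *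
    subst hdm
    rw [pow_succ', mul_assoc] at h1 h2
    have hp1 : b ^ j * a ≤ p := by
      by_contra h
      have : (b : ℤ) * (p + 1) ≤ b * (b ^ j * a) := mul_le_mul_of_nonneg_left (by omega) hb0.le
      linarith
    rcases hn.eq_or_lt with h0 | h0
    · subst h0
      rw [add_zero] at *
      rw [intWeight_mul hb]
      exact ih p hp1 (le_of_mul_le_mul_left h2 hb0)
    · have hp2 : p + 1 ≤ b ^ j * (a + 1) := by
        have : p < b ^ j * (a + 1) := lt_of_mul_lt_mul_left (by linarith) hb0.le
        omega
      rw [intWeight_mul_add hb _ _ h0 hlt]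
      have := ih p hp1 (by omega)
      have := ih (p + 1) (by omega) hp2
      omega

/-- An interval of length `4 * b ^ L` contains few integers of weight `d` that are not separated by
an integer of smaller weight. -/
lemma card_le_of_intWeight {b : ℕ} (hb : 3 ≤ b) (d L : ℕ) (S : Finset ℤ)
    (hd : ∀ m ∈ S, intWeight b m = d)
    (hS : ∀ m ∈ S, ∀ m' ∈ S, ∀ q, m ≤ q → q ≤ m' → d ≤ intWeight b q)
    (hL : ∀ m ∈ S, ∀ m' ∈ S, m' - m ≤ 4 * b ^ L) : S.card ≤ 2 * b * L + 5 := by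
  have hb0 : (0 : ℤ) < b := by omega
  induction L generalizing S with
  | zero =>
    rcases S.eq_empty_or_nonempty with rfl | hne
    · simp
    · have hsub : S ⊆ Finset.Icc (S.min' hne) (S.min' hne + 4) := by
        intro m hm
        have h1 := hL _ (S.min'_mem hne) m hm
        have h2 := S.min'_le m hm
        simp only [pow_zero] at h1
        rw [Finset.mem_Icc]
        omega
      have := Finset.card_le_card hsub
      simp only [Int.card_Icc] at this
      omega
  | succ L ih =>
    have hA : (S.filter (fun m => (b : ℤ) ∣ m)).card ≤ 2 * b * L + 5 := by
      have hinj : Set.InjOn (fun m : ℤ => m / b) (S.filter (fun m => (b : ℤ) ∣ m)) := by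
        intro m hm m' hm' h
        simp only [Finset.coe_filter, Set.mem_ofPred_eq] at hm hm'
        obtain ⟨_, k, rfl⟩ := hm
        obtain ⟨_, k', rfl⟩ := hm'
        simp only [Int.mul_ediv_cancel_left _ hb0.ne'] at h
        rw [h]
      have key : ∀ k ∈ (S.filter (fun m => (b : ℤ) ∣ m)).image (fun m : ℤ => m / b),
          (b : ℤ) * k ∈ S := by
        intro k hk
        simp only [Finset.mem_image, Finset.mem_filter] at hk
        obtain ⟨_, ⟨hm, l, rfl⟩, rfl⟩ := hk
        rwa [Int.mul_ediv_cancel_left _ hb0.ne']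
      rw [← Finset.card_image_of_injOn hinj]
      refine ih _ (fun k hk => ?_) (fun k hk k' hk' q h1 h2 => ?_) (fun k hk k' hk' => ?_)
      · rw [← intWeight_mul hb]
        exact hd _ (key k hk)
      · rw [← intWeight_mul hb]
        exact hS _ (key k hk) _ (key k' hk') _ (mul_le_mul_of_nonneg_left h1 hb0.le)
          (mul_le_mul_of_nonneg_left h2 hb0.le)
      · have := hL _ (key k hk) _ (key k' hk')
        rw [pow_succ] at this
        refine le_of_mul_le_mul_left ?_ hb0
        linarith
    have hB : (S.filter (fun m => ¬ (b : ℤ) ∣ m)).card ≤ 2 * b := by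
      set T := S.filter (fun m => ¬ (b : ℤ) ∣ m) with hT
      have hTS : ∀ m ∈ T, m ∈ S := fun m hm => (Finset.mem_filter.1 hm).1
      rcases T.eq_empty_or_nonempty with he | hne
      · rw [he]; simp
      have hsub : T ⊆ Finset.Ico (b * (T.min' hne / b)) (b * (T.min' hne / b) + b) ∪
          Finset.Ico (b * (T.max' hne / b)) (b * (T.max' hne / b) + b) := by
        intro m hm
        by_contra hcon
        have h1 := T.min'_mem hne
        have h2 := T.max'_mem hne
        have h3 := T.min'_le m hm
        have h4 := T.le_max' m hm
        generalize T.min' hne = x at *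
        generalize T.max' hne = y at *
        simp only [Finset.mem_union, Finset.mem_Ico, not_or, not_and, not_lt] at hcon
        have hx1 := Int.mul_ediv_add_emod x b
        have hx2 := Int.emod_lt_of_pos x hb0
        have hx3 := Int.emod_nonneg x hb0.ne'
        have hy1 := Int.mul_ediv_add_emod y b
        have hy2 := Int.emod_lt_of_pos y hb0
        have hy3 := Int.emod_nonneg y hb0.ne'
        have hm1 := Int.mul_ediv_add_emod m b
        have hm2 := Int.emod_lt_of_pos m hb0
        have hm3 := Int.emod_nonneg m hb0.ne'
        have hm0 : m % b ≠ 0 := fun h => (Finset.mem_filter.1 hm).2 (Int.dvd_of_emod_eq_zero h)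
        have c1 := hcon.1 (by omega)
        have c2 : m < b * (y / b) := by
          by_contra h
          have := hcon.2 (by omega)
          omega
        have k1 : x / b + 1 ≤ m / b := by
          by_contra h
          have : (b : ℤ) * (m / b) ≤ b * (x / b) := mul_le_mul_of_nonneg_left (by omega) hb0.le
          omega
        have k2 : m / b + 1 ≤ y / b := by
          by_contra h
          have : (b : ℤ) * (y / b) ≤ b * (m / b) := mul_le_mul_of_nonneg_left (by omega) hb0.le
          omega
        have e1 := mul_le_mul_of_nonneg_left k1 hb0.le
        have e2 := mul_le_mul_of_nonneg_left k2 hb0.le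
        rw [mul_add, mul_one] at e1 e2
        have w1 := hS _ (hTS _ h1) _ (hTS _ h2) (b * (m / b)) (by omega) (by omega)
        have w2 := hS _ (hTS _ h1) _ (hTS _ h2) (b * (m / b + 1)) (by rw [mul_add]; omega)
          (by rw [mul_add]; omega)
        rw [intWeight_mul hb] at w1 w2
        have w3 := hd _ (hTS _ hm)
        rw [← hm1, intWeight_mul_add hb _ _ (by omega) hm2] at w3
        omega
      refine (Finset.card_le_card hsub).trans ((Finset.card_union_le _ _).trans ?_)
      simp only [Int.card_Ico]
      omega
    rw [← Finset.card_filter_add_card_filter_not (s := S) (fun m => (b : ℤ) ∣ m)]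
    linarith

/-! ### Linked positions -/

/-- No `b`-adic point between `x` and `y` has weight less than `d`. -/
def Linked (b d : ℕ) (x y : ℝ) : Prop :=
  ∀ k q : ℤ, (q : ℝ) * (b : ℝ) ^ k ∈ Set.uIcc x y → d ≤ intWeight b q

lemma Linked.symm {b d : ℕ} {x y : ℝ} (h : Linked b d x y) : Linked b d y x := by
  intro k q hq
  rw [Set.uIcc_comm] at hq
  exact h k q hq

lemma Linked.trans {b d : ℕ} {x y z : ℝ} (h : Linked b d x y) (h' : Linked b d y z) :
    Linked b d x z := by
  intro k q hq
  rcases Set.uIcc_subset_uIcc_union_uIcc hq with hq | hq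
  · exact h k q hq
  · exact h' k q hq

lemma le_intWeight_of_mem_Icc {b d : ℕ} (hb : 3 ≤ b) (N m m' : ℤ)
    (h : ∀ q, m ≤ q → q ≤ m' → d ≤ intWeight b q) (k q : ℤ)
    (h1 : (m : ℝ) * (b : ℝ) ^ N ≤ q * (b : ℝ) ^ k) (h2 : (q : ℝ) * (b : ℝ) ^ k ≤ m' * (b : ℝ) ^ N) :
    d ≤ intWeight b q := by
  have hb0 : (0 : ℝ) < b := by positivity
  rcases le_total N k with hk | hk
  · obtain ⟨j, rfl⟩ := Int.le.dest hk
    have hN : (0 : ℝ) < (b : ℝ) ^ N := by positivity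
    rw [zpow_add₀ hb0.ne', zpow_natCast, mul_left_comm, mul_comm (_ ^ N)] at h1 h2
    have h1 := le_of_mul_le_mul_right h1 hN
    have h2 := le_of_mul_le_mul_right h2 hN
    rw [← intWeight_pow_mul hb j, mul_comm]
    exact h _ (by exact_mod_cast h1) (by exact_mod_cast h2)
  · obtain ⟨j, rfl⟩ := Int.le.dest hk
    have hN : (0 : ℝ) < (b : ℝ) ^ k := by positivity
    rw [zpow_add₀ hb0.ne', zpow_natCast, mul_left_comm, mul_comm (_ ^ k)] at h1 h2
    have h1 := le_of_mul_le_mul_right h1 hN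
    have h2 := le_of_mul_le_mul_right h2 hN
    have h1 : m * (b : ℤ) ^ j ≤ q := by exact_mod_cast h1
    have h2 : q ≤ m' * (b : ℤ) ^ j := by exact_mod_cast h2
    have hj : (0 : ℤ) < (b : ℤ) ^ j := by positivity
    have hm := Int.mul_ediv_add_emod q ((b : ℤ) ^ j)
    have hm1 := Int.emod_nonneg q hj.ne'
    have hm2 := Int.emod_lt_of_pos q hj
    have ha : m ≤ q / (b : ℤ) ^ j := (Int.le_ediv_iff_mul_le hj).2 h1
    have ha' : q / (b : ℤ) ^ j ≤ m' := by
      have := Int.ediv_le_ediv hj h2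
      rwa [Int.mul_ediv_cancel _ hj.ne'] at this
    rcases ha'.eq_or_lt with he | hlt
    · have : q = (b : ℤ) ^ j * m' := by
        rw [he, mul_comm] at hm
        linarith
      rw [this, intWeight_pow_mul hb]
      exact h _ (by omega) le_rfl
    · have := min_le_intWeight hb j (q / (b : ℤ) ^ j) q (by linarith)
        (by rw [mul_add]; linarith)
      have w1 := h _ ha ha'
      have w2 := h (q / (b : ℤ) ^ j + 1) (by omega) (by omega)
      omega

lemma linked_of_grid {b d : ℕ} (hb : 3 ≤ b) (N m m' : ℤ)
    (h : ∀ q ∈ Set.uIcc m m', d ≤ intWeight b q) :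
    Linked b d (m * (b : ℝ) ^ N) (m' * (b : ℝ) ^ N) := by
  intro k q hq
  have hN : (0 : ℝ) ≤ (b : ℝ) ^ N := by positivity
  rcases le_total m m' with hm | hm
  · rw [Set.uIcc_of_le (mul_le_mul_of_nonneg_right (by exact_mod_cast hm) hN)] at hq
    rw [Set.uIcc_of_le hm] at h
    exact le_intWeight_of_mem_Icc hb N m m' (fun q h1 h2 => h q ⟨h1, h2⟩) k q hq.1 hq.2
  · rw [Set.uIcc_of_ge (mul_le_mul_of_nonneg_right (by exact_mod_cast hm) hN)] at hq
    rw [Set.uIcc_of_ge hm] at h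
    exact le_intWeight_of_mem_Icc hb N m' m (fun q h1 h2 => h q ⟨h1, h2⟩) k q hq.1 hq.2

/-! ### Cells of the hyperbolic plane -/

/-- The level of the cell containing `z`. -/
noncomputable def cellLevel (b : ℕ) (z : UpperHalfPlane) : ℤ := Int.log b z.im

/-- The horizontal index, within its level, of the cell containing `z`. -/
noncomputable def cellIndex (b : ℕ) (z : UpperHalfPlane) : ℤ :=
  ⌊z.re / (b : ℝ) ^ (cellLevel b z + 3)⌋

/-- The position on the real line of the left end of the cell containing `z`. -/
noncomputable def cellPos (b : ℕ) (z : UpperHalfPlane) : ℝ :=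
  cellIndex b z * (b : ℝ) ^ (cellLevel b z + 3)

lemma zpow_cellLevel_le {b : ℕ} (hb : 3 ≤ b) (z : UpperHalfPlane) :
    (b : ℝ) ^ cellLevel b z ≤ z.im :=
  Int.zpow_log_le_self (by omega) z.im_pos

lemma lt_zpow_cellLevel {b : ℕ} (hb : 3 ≤ b) (z : UpperHalfPlane) :
    z.im < (b : ℝ) ^ (cellLevel b z + 1) :=
  Int.lt_zpow_succ_log_self (by omega) z.im

lemma cellLevel_le_add {b : ℕ} (hb : 3 ≤ b) (z w : UpperHalfPlane) (M : ℕ)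
    (h : Real.exp (dist z w) ≤ (b : ℝ) ^ M) : cellLevel b z ≤ cellLevel b w + M := by
  have hb1 : (1 : ℝ) < b := by exact_mod_cast (by omega : 1 < b)
  have h1 := UpperHalfPlane.im_le_im_mul_exp_dist z w
  have h2 : (b : ℝ) ^ cellLevel b z < (b : ℝ) ^ (cellLevel b w + 1 + M) := by
    rw [zpow_add₀ (by positivity), zpow_natCast]
    calc _ ≤ z.im := zpow_cellLevel_le hb z
      _ ≤ w.im * Real.exp (dist z w) := h1
      _ ≤ w.im * (b : ℝ) ^ M := mul_le_mul_of_nonneg_left h w.im_pos.le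
      _ < _ := mul_lt_mul_of_pos_right (lt_zpow_cellLevel hb w) (by positivity)
  have := (zpow_lt_zpow_iff_right₀ hb1).1 h2
  omega

lemma abs_re_sub_le {b : ℕ} (hb : 3 ≤ b) (z w : UpperHalfPlane) (M : ℕ)
    (h : Real.exp (dist z w) ≤ (b : ℝ) ^ M) :
    |z.re - w.re| ≤ (b : ℝ) ^ (cellLevel b w + 1 + M) := by
  have hb0 : (0 : ℝ) < b := by positivity
  have h1 : |z.re - w.re| ≤ dist (z : ℂ) w := by
    rw [Complex.dist_eq]
    exact Complex.abs_re_le_norm ((z : ℂ) - w)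
  rw [zpow_add₀ hb0.ne', zpow_natCast]
  calc |z.re - w.re| ≤ _ := h1
    _ ≤ w.im * (Real.exp (dist z w) - 1) := UpperHalfPlane.dist_coe_le z w
    _ ≤ w.im * (b : ℝ) ^ M := mul_le_mul_of_nonneg_left (by linarith) w.im_pos.le
    _ ≤ _ := mul_le_mul_of_nonneg_right (lt_zpow_cellLevel hb w).le (by positivity)

/-- Nearby points have cells whose weights differ by at most one; if the weights agree, the
positions of the cells are linked. -/
lemma cell_of_dist_lt_of_le {b : ℕ} (hb : 3 ≤ b) {r : ℝ} (hr : Real.exp r ≤ b)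
    (z w : UpperHalfPlane) (hzw : dist z w < r) (hle : cellLevel b w ≤ cellLevel b z) :
    intWeight b (cellIndex b z) ≤ intWeight b (cellIndex b w) + 1 ∧
    intWeight b (cellIndex b w) ≤ intWeight b (cellIndex b z) + 1 ∧
    (intWeight b (cellIndex b w) = intWeight b (cellIndex b z) →
      Linked b (intWeight b (cellIndex b z)) (cellPos b z) (cellPos b w)) := by
  have hb0 : (0 : ℝ) < b := by positivity
  have hb1 : (1 : ℝ) ≤ b := by exact_mod_cast (by omega : 1 ≤ b)
  have hexp : Real.exp (dist z w) ≤ (b : ℝ) ^ 1 := by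
    rw [pow_one]
    exact (Real.exp_le_exp.2 hzw.le).trans hr
  have hlev := cellLevel_le_add hb z w 1 hexp
  have hre : |z.re - w.re| ≤ (b : ℝ) ^ (cellLevel b w + 3) :=
    (abs_re_sub_le hb z w 1 hexp).trans (zpow_le_zpow_right₀ hb1 (by push_cast; omega))
  have hp : (0 : ℝ) < (b : ℝ) ^ (cellLevel b w + 3) := by positivity
  set t := z.re / (b : ℝ) ^ (cellLevel b w + 3) with ht
  have htw : |t - w.re / (b : ℝ) ^ (cellLevel b w + 3)| ≤ 1 := by
    rw [ht, ← sub_div, abs_div, abs_of_pos hp]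
    exact div_le_one_of_le₀ hre hp.le
  rw [abs_le] at htw
  have hf1 : ⌊t⌋ ≤ cellIndex b w + 1 := by
    rw [cellIndex, ← Int.floor_add_one]
    exact Int.floor_le_floor (by linarith)
  have hf2 : cellIndex b w ≤ ⌊t⌋ + 1 := by
    rw [cellIndex, ← Int.floor_add_one]
    exact Int.floor_le_floor (by linarith)
  rcases hle.eq_or_lt with he | hlt
  · have hz : cellIndex b z = ⌊t⌋ := by rw [cellIndex, ← he]
    rw [cellPos, cellPos, ← he, hz]
    have hcase : cellIndex b w = ⌊t⌋ ∨ cellIndex b w = ⌊t⌋ + 1 ∨ ⌊t⌋ = cellIndex b w + 1 := by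
      omega
    refine ⟨?_, ?_, fun hd => linked_of_grid hb _ _ _ fun q hq => ?_⟩
    · have h1 := intWeight_succ hb ⌊t⌋
      have h2 := intWeight_succ hb (cellIndex b w)
      rcases hcase with h | h | h <;> rw [h] at * <;> omega
    · have h1 := intWeight_succ hb ⌊t⌋
      have h2 := intWeight_succ hb (cellIndex b w)
      rcases hcase with h | h | h <;> rw [h] at * <;> omega
    · rw [Set.mem_uIcc] at hq
      obtain rfl | rfl : q = ⌊t⌋ ∨ q = cellIndex b w := by omega
      · exact le_rfl
      · exact hd.ge
  · have he : cellLevel b z = cellLevel b w + 1 := by push_cast at hlev; omega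
    have hz : cellIndex b z = ⌊t / b⌋ := by
      rw [cellIndex, he, ht, div_div, ← zpow_add_one₀ hb0.ne']
      congr 3
      ring
    set m := cellIndex b z with hm
    have hm1 : (b : ℤ) * m ≤ ⌊t⌋ := by
      rw [Int.le_floor]
      push_cast
      have := Int.floor_le (t / b)
      rw [← hz, le_div_iff₀ hb0] at this
      linarith
    have hm2 : ⌊t⌋ < (b : ℤ) * m + b := by
      rw [Int.floor_lt]
      push_cast
      have := Int.lt_floor_add_one (t / b)
      rw [← hz, div_lt_iff₀ hb0] at this
      linarith
    obtain ⟨u, hu⟩ : ∃ u, cellIndex b w = b * m + u := ⟨cellIndex b w - b * m, by ring⟩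
    have hposz : cellPos b z = ((b * m : ℤ) : ℝ) * (b : ℝ) ^ (cellLevel b w + 3) := by
      rw [cellPos, he, ← hm, show cellLevel b w + 1 + 3 = (cellLevel b w + 3) + 1 by ring,
        zpow_add_one₀ hb0.ne']
      push_cast
      ring
    rcases lt_or_ge |u| (b : ℤ) with hub | hub
    · have hw := intWeight_mul_add_bounds hb m u hub
      rw [hu]
      refine ⟨by omega, by omega, fun _ => ?_⟩
      rw [hposz, cellPos, hu]
      refine linked_of_grid hb _ _ _ fun q hq => ?_
      have e : q = b * m + (q - b * m) := by ring
      rw [e]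
      refine (intWeight_mul_add_bounds hb m _ ?_).1
      rw [Set.mem_uIcc] at hq
      rw [abs_lt] at *
      omega
    · have hub' : u = b := by
        rcases abs_cases u with h | h <;> omega
      have e : cellIndex b w = b * (m + 1) := by rw [hu, hub']; ring
      have hs := intWeight_succ hb m
      have hcw : intWeight b (cellIndex b w) = intWeight b (m + 1) := by
        rw [e, intWeight_mul hb]
      rw [hcw]
      refine ⟨by omega, by omega, fun hd => ?_⟩
      rw [hposz, cellPos, hu]
      refine linked_of_grid hb _ _ _ fun q hq => ?_
      rw [Set.uIcc_of_le (by omega), hub'] at hq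
      rcases hq.2.eq_or_lt with h | h
      · rw [h, show (b : ℤ) * m + b = b * (m + 1) by ring, intWeight_mul hb]
        exact hd.ge
      · have e : q = b * m + (q - b * m) := by ring
        rw [e]
        refine (intWeight_mul_add_bounds hb m _ ?_).1
        have := hq.1
        rw [abs_lt]
        omega

lemma cell_of_dist_lt {b : ℕ} (hb : 3 ≤ b) {r : ℝ} (hr : Real.exp r ≤ b)
    (z w : UpperHalfPlane) (hzw : dist z w < r) :
    intWeight b (cellIndex b z) ≤ intWeight b (cellIndex b w) + 1 ∧
    intWeight b (cellIndex b w) ≤ intWeight b (cellIndex b z) + 1 ∧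
    (intWeight b (cellIndex b w) = intWeight b (cellIndex b z) →
      Linked b (intWeight b (cellIndex b z)) (cellPos b z) (cellPos b w)) := by
  rcases le_total (cellLevel b w) (cellLevel b z) with h | h
  · exact cell_of_dist_lt_of_le hb hr z w hzw h
  · obtain ⟨h1, h2, h3⟩ := cell_of_dist_lt_of_le hb hr w z (by rwa [dist_comm]) h
    refine ⟨h2, h1, fun he => ?_⟩
    rw [← he]
    exact (h3 he.symm).symm

/-! ### Counting -/

/-- A cell contains boundedly many points of a `1`-separated set. -/
lemma card_cell_le {b : ℕ} (hb : 3 ≤ b) (t : Finset UpperHalfPlane)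
    (hsep : ∀ x ∈ t, ∀ y ∈ t, x ≠ y → 1 ≤ dist x y) (n m : ℤ)
    (hn : ∀ x ∈ t, cellLevel b x = n) (hm : ∀ x ∈ t, cellIndex b x = m) :
    t.card ≤ 4 * b ^ 4 := by
  have hb0 : (0 : ℝ) < b := by positivity
  have hp : (0 : ℝ) < (b : ℝ) ^ n := by positivity
  let f : UpperHalfPlane → ℤ × ℤ :=
    fun z => (⌊2 * z.re / (b : ℝ) ^ n⌋, ⌊2 * z.im / (b : ℝ) ^ n⌋)
  have hmaps : ∀ z ∈ t, f z ∈
      Finset.Ico (2 * b ^ 3 * m : ℤ) (2 * b ^ 3 * m + 2 * b ^ 3) ×ˢ Finset.Ico (0 : ℤ) (2 * b) := by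
    intro z hz
    have h1 := zpow_cellLevel_le hb z
    have h2 := lt_zpow_cellLevel hb z
    have h3 := hm z hz
    rw [hn z hz] at h1 h2
    rw [cellIndex, hn z hz, Int.floor_eq_iff, zpow_add₀ hb0.ne', le_div_iff₀ (by positivity),
      div_lt_iff₀ (by positivity)] at h3
    rw [zpow_add_one₀ hb0.ne'] at h2
    norm_cast at h3
    push_cast at h3
    simp only [f, Finset.mem_product, Finset.mem_Ico, Int.le_floor, Int.floor_lt,
      le_div_iff₀ hp, div_lt_iff₀ hp]
    push_cast
    refine ⟨⟨by linarith, by linarith⟩, ?_, by linarith⟩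
    have := z.im_pos
    linarith
  have hinj : Set.InjOn f t := by
    intro z hz w hw h
    by_contra hne
    have hd := hsep z hz w hw hne
    simp only [f, Prod.mk.injEq] at h
    have h1 := Int.abs_sub_lt_one_of_floor_eq_floor h.1
    have h2 := Int.abs_sub_lt_one_of_floor_eq_floor h.2
    rw [← sub_div, abs_div, abs_of_pos hp, div_lt_one hp, ← mul_sub, abs_mul, abs_two] at h1 h2
    have hz1 := zpow_cellLevel_le hb z
    have hw1 := zpow_cellLevel_le hb w
    rw [hn z hz] at hz1
    rw [hn w hw] at hw1
    have hs : (b : ℝ) ^ n ≤ √(z.im * w.im) := by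
      apply Real.le_sqrt_of_sq_le
      rw [sq]
      exact mul_le_mul hz1 hw1 hp.le z.im_pos.le
    have hc : dist (z : ℂ) w < (b : ℝ) ^ n := by
      rw [Complex.dist_eq]
      refine (Complex.norm_le_abs_re_add_abs_im _).trans_lt ?_
      simp only [Complex.sub_re, Complex.sub_im, UpperHalfPlane.coe_re, UpperHalfPlane.coe_im]
      linarith
    have := UpperHalfPlane.dist_le_dist_coe_div_sqrt z w
    have : dist (z : ℂ) w / √(z.im * w.im) < 1 := by
      rw [div_lt_one (hp.trans_le hs)]
      exact hc.trans_le hs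
    linarith
  refine (Finset.card_le_card_of_injOn f hmaps hinj).trans ?_
  rw [Finset.card_product, Int.card_Ico, Int.card_Ico]
  have e1 : (2 * (b : ℤ) ^ 3 * m + 2 * b ^ 3 - 2 * b ^ 3 * m).toNat = 2 * b ^ 3 := by
    have : 2 * (b : ℤ) ^ 3 * m + 2 * b ^ 3 - 2 * b ^ 3 * m = ((2 * b ^ 3 : ℕ) : ℤ) := by
      push_cast
      ring
    rw [this, Int.toNat_natCast]
  have e2 : (2 * (b : ℤ) - 0).toNat = 2 * b := by omega
  rw [e1, e2]
  apply le_of_eq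
  ring

/-- A linked family of cells of constant weight meets balls in quadratically many points of a
`1`-separated set. -/
lemma card_linked_le {b : ℕ} (hb : 3 ≤ b) (d : ℕ) (t : Finset UpperHalfPlane)
    (hsep : ∀ x ∈ t, ∀ y ∈ t, x ≠ y → 1 ≤ dist x y)
    (hd : ∀ x ∈ t, intWeight b (cellIndex b x) = d)
    (hl : ∀ x ∈ t, ∀ y ∈ t, Linked b d (cellPos b x) (cellPos b y))
    (o : UpperHalfPlane) (M : ℕ) (hM : ∀ x ∈ t, dist x o ≤ M) :
    t.card ≤ 4 * b ^ 4 * (2 * b * (2 * M) + 5) * (2 * M + 1) := by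
  have hb0 : (0 : ℝ) < b := by positivity
  have hb1 : (1 : ℝ) ≤ b := by exact_mod_cast (by omega : 1 ≤ b)
  have hexp : ∀ x ∈ t, Real.exp (dist x o) ≤ (b : ℝ) ^ M := by
    intro x hx
    have h3 : Real.exp 1 ≤ b := by
      have := Real.exp_one_lt_d9
      have : (3 : ℝ) ≤ b := by exact_mod_cast hb
      linarith
    calc Real.exp (dist x o) ≤ Real.exp M := Real.exp_le_exp.2 (hM x hx)
      _ = Real.exp 1 ^ M := by rw [← Real.exp_nat_mul, mul_one]
      _ ≤ _ := pow_le_pow_left₀ (Real.exp_pos 1).le h3 M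
  have hlow : ∀ x ∈ t, cellLevel b o ≤ cellLevel b x + M := fun x hx =>
    cellLevel_le_add hb o x M (by rw [dist_comm]; exact hexp x hx)
  have hlevel : (t.image (cellLevel b)).card ≤ 2 * M + 1 := by
    have hsub : t.image (cellLevel b) ⊆ Finset.Icc (cellLevel b o - M) (cellLevel b o + M) := by
      intro n hn
      obtain ⟨x, hx, rfl⟩ := Finset.mem_image.1 hn
      have h1 := cellLevel_le_add hb x o M (hexp x hx)
      have h2 := hlow x hx
      rw [Finset.mem_Icc]
      omega
    have := Finset.card_le_card hsub
    rw [Int.card_Icc] at this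
    omega
  refine (Finset.card_le_mul_card_image (f := cellLevel b) t
    (4 * b ^ 4 * (2 * b * (2 * M) + 5)) fun n _ => ?_).trans (Nat.mul_le_mul_left _ hlevel)
  set T := t.filter (fun x => cellLevel b x = n) with hT
  have hTt : ∀ x ∈ T, x ∈ t := fun x hx => (Finset.mem_filter.1 hx).1
  have hTn : ∀ x ∈ T, cellLevel b x = n := fun x hx => (Finset.mem_filter.1 hx).2
  refine (Finset.card_le_mul_card_image (f := cellIndex b) T (4 * b ^ 4) fun m _ => ?_).trans
    (Nat.mul_le_mul_left _ (card_le_of_intWeight hb d (2 * M) _ ?_ ?_ ?_))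
  · have hF : ∀ x ∈ T.filter (fun x => cellIndex b x = m), x ∈ T :=
      fun x hx => (Finset.mem_filter.1 hx).1
    exact card_cell_le hb _ (fun x hx y hy => hsep x (hTt x (hF x hx)) y (hTt y (hF y hy))) n m
      (fun x hx => hTn x (hF x hx)) (fun x hx => (Finset.mem_filter.1 hx).2)
  · intro m hm
    obtain ⟨x, hx, rfl⟩ := Finset.mem_image.1 hm
    exact hd x (hTt x hx)
  · intro m hm m' hm' q h1 h2
    obtain ⟨x, hx, rfl⟩ := Finset.mem_image.1 hm
    obtain ⟨y, hy, rfl⟩ := Finset.mem_image.1 hm'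
    refine hl x (hTt x hx) y (hTt y hy) (n + 3) q (Set.mem_uIcc_of_le ?_ ?_)
    · rw [cellPos, hTn x hx]
      exact mul_le_mul_of_nonneg_right (by exact_mod_cast h1) (by positivity)
    · rw [cellPos, hTn y hy]
      exact mul_le_mul_of_nonneg_right (by exact_mod_cast h2) (by positivity)
  · intro m hm m' hm'
    obtain ⟨x, hx, rfl⟩ := Finset.mem_image.1 hm
    obtain ⟨y, hy, rfl⟩ := Finset.mem_image.1 hm'
    have hp : (0 : ℝ) < (b : ℝ) ^ (n + 3) := by positivity
    have hox := hlow x (hTt x hx)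
    have h1 := abs_re_sub_le hb x o M (hexp x (hTt x hx))
    have h2 := abs_re_sub_le hb y o M (hexp y (hTt y hy))
    have h3 : (b : ℝ) ^ (cellLevel b o + 1 + M) ≤ (b : ℝ) ^ (2 * M) * (b : ℝ) ^ (n + 3) := by
      rw [← zpow_natCast, ← zpow_add₀ hb0.ne']
      refine zpow_le_zpow_right₀ hb1 ?_
      rw [hTn x hx] at hox
      push_cast
      omega
    have hxf := Int.lt_floor_add_one (x.re / (b : ℝ) ^ (n + 3))
    have hyf := Int.floor_le (y.re / (b : ℝ) ^ (n + 3))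
    rw [cellIndex, cellIndex, hTn x hx, hTn y hy]
    have h4 : y.re / (b : ℝ) ^ (n + 3) - x.re / (b : ℝ) ^ (n + 3) ≤ 2 * (b : ℝ) ^ (2 * M) := by
      rw [← sub_div, div_le_iff₀ hp]
      rw [abs_le] at h1 h2
      linarith
    have h5 : (1 : ℝ) ≤ (b : ℝ) ^ (2 * M) := one_le_pow₀ hb1
    have : ((⌊y.re / (b : ℝ) ^ (n + 3)⌋ - ⌊x.re / (b : ℝ) ^ (n + 3)⌋ : ℤ) : ℝ)
        ≤ ((4 * b ^ (2 * M) : ℤ) : ℝ) := by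
      push_cast
      linarith
    exact_mod_cast this

/-! ### The decomposition -/

/-- The points of `X` whose cell has weight `d` and position linked to `a`. -/
def linkedPiece (X : Set UpperHalfPlane) (b d : ℕ) (a : ℝ) : Set X :=
  {x | intWeight b (cellIndex b x) = d ∧ Linked b d a (cellPos b x)}

lemma sepFamily_linkedPiece (X : Set UpperHalfPlane) {b : ℕ} (hb : 3 ≤ b) {r : ℝ}
    (hr : Real.exp r ≤ b) (i : ℕ) :
    SepFamily r {U | ∃ d a, d % 2 = i ∧ U = linkedPiece X b d a} := by
  rintro U ⟨d, a, hd, rfl⟩ V ⟨d', a', hd', rfl⟩ hne x ⟨hx, hxl⟩ y ⟨hy, hyl⟩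
  by_contra! hlt
  obtain ⟨h1, h2, h3⟩ := cell_of_dist_lt hb hr (x : UpperHalfPlane) y hlt
  rw [hx, hy] at h1 h2 h3
  obtain rfl : d = d' := by omega
  have haa : Linked b d a a' := (hxl.trans (h3 rfl)).trans hyl.symm
  refine hne (Set.ext fun z => and_congr_right fun _ => ⟨haa.symm.trans, haa.trans⟩)

lemma card_linkedPiece_le (X : Set UpperHalfPlane)
    (hsep : ∀ x ∈ X, ∀ y ∈ X, x ≠ y → 1 ≤ dist x y) {b : ℕ} (hb : 3 ≤ b) (d : ℕ) (a : ℝ)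
    (x : X) (s : ℝ) (hs : 0 ≤ s) (t : Finset X)
    (ht : ↑t ⊆ linkedPiece X b d a ∩ Metric.closedBall x s) :
    (t.card : ℝ) ≤ (24 * b ^ 4 * (4 * b + 5)) * s ^ 2 + 24 * b ^ 4 * (4 * b + 5) := by
  have hmem : ∀ y ∈ t.map (Function.Embedding.subtype _), ∃ h : y ∈ X, (⟨y, h⟩ : X) ∈ t := by
    intro y hy
    obtain ⟨z, hz, rfl⟩ := Finset.mem_map.1 hy
    exact ⟨z.2, hz⟩
  have key := card_linked_le hb d (t.map (Function.Embedding.subtype _))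
    (fun y hy z hz => hsep y (hmem y hy).1 z (hmem z hz).1)
    (fun y hy => (ht (hmem y hy).2).1.1)
    (fun y hy z hz => (ht (hmem y hy).2).1.2.symm.trans (ht (hmem z hz).2).1.2)
    x ⌈s⌉₊ (fun y hy => le_trans (ht (hmem y hy).2).2 (Nat.le_ceil s))
  rw [Finset.card_map] at key
  have hM := (Nat.ceil_lt_add_one hs).le
  have key' : (t.card : ℝ) ≤ 4 * b ^ 4 * (2 * b * (2 * ⌈s⌉₊) + 5) * (2 * ⌈s⌉₊ + 1) := by
    exact_mod_cast key
  have hb0 : (0 : ℝ) ≤ b := by positivity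
  have h1 : 2 * (b : ℝ) * (2 * ⌈s⌉₊) + 5 ≤ (4 * b + 5) * (s + 1) := by nlinarith
  have h2 : 2 * (⌈s⌉₊ : ℝ) + 1 ≤ 3 * (s + 1) := by linarith
  calc (t.card : ℝ) ≤ 4 * b ^ 4 * (2 * b * (2 * ⌈s⌉₊) + 5) * (2 * ⌈s⌉₊ + 1) := key'
    _ ≤ 4 * b ^ 4 * ((4 * b + 5) * (s + 1)) * (3 * (s + 1)) := by gcongr
    _ = 12 * b ^ 4 * (4 * b + 5) * (s + 1) ^ 2 := by ring
    _ ≤ 12 * b ^ 4 * (4 * b + 5) * (2 * (s ^ 2 + 1)) := by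
      gcongr
      nlinarith [sq_nonneg (s - 1)]
    _ = _ := by ring

/-! ### One colour does not suffice -/

/-- A one-coloured `3`-separated decomposition of a `1`-dense subset of the hyperbolic plane has
a piece containing everything. -/
lemma exists_piece_eq_univ (X : Set UpperHalfPlane)
    (hmax : ∀ z : UpperHalfPlane, ∃ x ∈ X, dist z x ≤ 1) (𝒰 : Set (Set X))
    (hcov : ∀ x : X, ∃ U ∈ 𝒰, x ∈ U) (hU : SepFamily 3 𝒰) : ∃ U ∈ 𝒰, ∀ x, x ∈ U := by
  have hmax' : ∀ z : UpperHalfPlane, ∃ x : X, dist z x ≤ 1 := fun z => by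
    obtain ⟨x, hx, h⟩ := hmax z
    exact ⟨⟨x, hx⟩, h⟩
  choose f hf using hmax'
  obtain ⟨U, hUm, hfU⟩ := hcov (f UpperHalfPlane.I)
  have hsame : ∀ x y : X, dist x y < 3 → x ∈ U → y ∈ U := by
    intro x y hxy hx
    obtain ⟨V, hV, hy⟩ := hcov y
    by_cases h : U = V
    · rwa [h]
    · exact absurd (hU U hUm V hV h x hx y hy) (not_le.2 hxy)
  have hnear : ∀ z w : UpperHalfPlane, dist w z < 1 → dist (f z) (f w) < 3 := by
    intro z w hzw
    have h1 := hf z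
    have h2 := hf w
    have h3 := dist_triangle4 (f z : UpperHalfPlane) z w (f w)
    rw [dist_comm _ z, dist_comm z w] at h3
    rw [Subtype.dist_eq]
    linarith
  have hclopen : IsClopen {z | f z ∈ U} := by
    constructor
    · rw [← isOpen_compl_iff, Metric.isOpen_iff]
      intro z hz
      exact ⟨1, one_pos, fun w hw hwU => hz (hsame _ _ (by
        rw [dist_comm]; exact hnear z w hw) hwU)⟩
    · rw [Metric.isOpen_iff]
      intro z hz
      exact ⟨1, one_pos, fun w hw => hsame _ _ (hnear z w hw) hz⟩
  have huniv := hclopen.eq_univ ⟨_, hfU⟩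
  refine ⟨U, hUm, fun x => hsame (f x) x ?_ (huniv.ge (Set.mem_univ (x : UpperHalfPlane)))⟩
  have := hf x
  rw [Subtype.dist_eq, dist_comm]
  linarith

/-- The point of the horocycle `im = 1` with real part `10 * k`. -/
def horocyclePoint (k : ℕ) : UpperHalfPlane := ⟨⟨10 * k, 1⟩, one_pos⟩

lemma sinh_half_dist_horocyclePoint (k l : ℕ) :
    Real.sinh (dist (horocyclePoint k) (horocyclePoint l) / 2) = 5 * |(k : ℝ) - l| := by
  have hre : dist (horocyclePoint k : ℂ) (horocyclePoint l) = 10 * |(k : ℝ) - l| := by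
    have : (horocyclePoint k : ℂ) - horocyclePoint l = ((10 * ((k : ℝ) - l) : ℝ) : ℂ) := by
      apply Complex.ext <;> simp [horocyclePoint]
      ring
    rw [Complex.dist_eq, this, Complex.norm_real, Real.norm_eq_abs, abs_mul]
    norm_num
  have him : ∀ k, (horocyclePoint k).im = 1 := fun _ => rfl
  rw [UpperHalfPlane.sinh_half_dist, hre, him, him]
  norm_num
  ring

lemma two_lt_dist_horocyclePoint {k l : ℕ} (h : k ≠ l) :
    2 < dist (horocyclePoint k) (horocyclePoint l) := by
  have h1 : (1 : ℝ) ≤ |(k : ℝ) - l| := by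
    have : (1 : ℤ) ≤ |(k : ℤ) - l| := Int.one_le_abs (by omega)
    exact_mod_cast this
  have h2 : Real.sinh 1 < Real.sinh (dist (horocyclePoint k) (horocyclePoint l) / 2) := by
    rw [sinh_half_dist_horocyclePoint, Real.sinh_eq]
    have := Real.exp_one_lt_d9
    have := Real.exp_pos (-1)
    linarith
  have := Real.sinh_lt_sinh.1 h2
  linarith

lemma dist_horocyclePoint_zero_le {k T : ℕ} (hT : 1 ≤ T) (hk : k ≤ T ^ 3) :
    dist (horocyclePoint k) (horocyclePoint 0) ≤ 12 * T := by
  have hT' : (1 : ℝ) ≤ T := by exact_mod_cast hT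
  have hk' : (k : ℝ) ≤ (T : ℝ) ^ 3 := by exact_mod_cast hk
  have h2 : Real.sinh (dist (horocyclePoint k) (horocyclePoint 0) / 2) ≤ Real.sinh (6 * T) := by
    rw [sinh_half_dist_horocyclePoint, Real.sinh_eq]
    have h3 := Real.pow_div_factorial_le_exp (6 * (T : ℝ)) (by positivity) 3
    have h4 : Real.exp (-(6 * (T : ℝ))) ≤ 1 := Real.exp_le_one_iff.2 (by linarith)
    have h5 : (1 : ℝ) ≤ (T : ℝ) ^ 3 := one_le_pow₀ hT'
    norm_num [Nat.factorial] at h3 ⊢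
    ring_nf at h3 h4 ⊢
    linarith
  have := Real.sinh_le_sinh.1 h2
  linarith

/-- A `1`-dense subset of the hyperbolic plane does not have quadratic growth. -/
lemma not_quadratic_growth (X : Set UpperHalfPlane)
    (hmax : ∀ z : UpperHalfPlane, ∃ x ∈ X, dist z x ≤ 1) (C : ℝ) (hC : 1 ≤ C)
    (h : ∀ (x : X) (s : ℝ), 0 ≤ s → ∀ t : Finset X, ↑t ⊆ Metric.closedBall x s →
      (t.card : ℝ) ≤ C * s ^ 2 + C) : False := by
  have hmax' : ∀ k : ℕ, ∃ x : X, dist (horocyclePoint k) x ≤ 1 := fun k => by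
    obtain ⟨x, hx, h⟩ := hmax (horocyclePoint k)
    exact ⟨⟨x, hx⟩, h⟩
  choose f hf using hmax'
  have hinj : Function.Injective f := by
    intro k l hkl
    by_contra hne
    have h1 := two_lt_dist_horocyclePoint hne
    have h2 := dist_triangle_right (horocyclePoint k) (horocyclePoint l) (f k : UpperHalfPlane)
    have h3 := hf k
    have h4 := hf l
    rw [← hkl] at h4
    linarith
  obtain ⟨T, hT⟩ := exists_nat_gt (257 * C)
  have hT1 : (1 : ℝ) ≤ T := by linarith
  have hT1' : 1 ≤ T := by exact_mod_cast hT1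
  have hcard := h (f 0) (12 * T + 2) (by positivity)
    ((Finset.range (T ^ 3)).map ⟨f, hinj⟩) (by
      intro y hy
      obtain ⟨k, hk, rfl⟩ := Finset.mem_map.1 (Finset.mem_coe.1 hy)
      have h1 := dist_horocyclePoint_zero_le hT1' (Finset.mem_range.1 hk).le
      have h2 := dist_triangle4 (f k : UpperHalfPlane) (horocyclePoint k) (horocyclePoint 0) (f 0)
      have h3 := hf k
      rw [dist_comm] at h3
      have h4 := hf 0
      rw [Metric.mem_closedBall, Subtype.dist_eq]
      change dist (f k : UpperHalfPlane) (f 0) ≤ _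
      linarith)
  rw [Finset.card_map, Finset.card_range] at hcard
  push_cast at hcard
  have hsq : (12 * (T : ℝ) + 2) ^ 2 ≤ 256 * (T : ℝ) ^ 2 := by nlinarith
  have h1 : (1 : ℝ) ≤ (T : ℝ) ^ 2 := one_le_pow₀ hT1
  have h2 : (T : ℝ) ^ 3 ≤ 257 * C * (T : ℝ) ^ 2 := by nlinarith
  have h3 : (T : ℝ) ^ 3 = T * (T : ℝ) ^ 2 := by ring
  rw [h3] at h2
  have := le_of_mul_le_mul_right h2 (by linarith)
  linarith

/-- For a maximal 1-separated subset `X` of the hyperbolic plane,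
`asdim_{poly(2)}(X) = 1`: for every `r > 0` there is a two-coloured decomposition into
`r`-separated pieces of uniformly quadratic growth, and for some `r > 0` no such
one-coloured decomposition exists. -/
theorem asdim_poly2_hyperbolic_plane_eq_one
    (X : Set UpperHalfPlane)
    (hsep : ∀ x ∈ X, ∀ y ∈ X, x ≠ y → 1 ≤ dist x y)
    (hmax : ∀ z : UpperHalfPlane, ∃ x ∈ X, dist z x ≤ 1) :
    (∀ r : ℝ, 0 < r → ∃ C : ℝ, 1 ≤ C ∧ ∃ 𝒰 : Fin 2 → Set (Set ↥X),
      Decomp 1 r 𝒰 ∧ ∀ U ∈ ⋃ i, 𝒰 i, ∀ (x : ↥X) (s : ℝ), 0 ≤ s →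
        ∀ t : Finset ↥X, ↑t ⊆ U ∩ Metric.closedBall x s →
          (t.card : ℝ) ≤ C * s ^ 2 + C) ∧
    (∃ r : ℝ, 0 < r ∧ ¬ ∃ C : ℝ, 1 ≤ C ∧ ∃ 𝒰 : Fin 1 → Set (Set ↥X),
      Decomp 0 r 𝒰 ∧ ∀ U ∈ ⋃ i, 𝒰 i, ∀ (x : ↥X) (s : ℝ), 0 ≤ s →
        ∀ t : Finset ↥X, ↑t ⊆ U ∩ Metric.closedBall x s →
          (t.card : ℝ) ≤ C * s ^ 2 + C) := by
  refine ⟨fun r _ => ?_, 3, by norm_num, ?_⟩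
  · obtain ⟨b, hb⟩ := exists_nat_ge (max (Real.exp r) 3)
    have hr : Real.exp r ≤ b := (le_max_left _ _).trans hb
    have hb3 : 3 ≤ b := by exact_mod_cast (le_max_right _ _).trans hb
    have hb1 : (1 : ℝ) ≤ b := by exact_mod_cast (by omega : 1 ≤ b)
    refine ⟨24 * b ^ 4 * (4 * b + 5), ?_,
      fun i => {U | ∃ d a, d % 2 = (i : ℕ) ∧ U = linkedPiece X b d a}, ⟨fun x => ?_, fun i => ?_⟩,
      fun U hU x s hs t ht => ?_⟩
    · have : (1 : ℝ) ≤ (b : ℝ) ^ 4 := one_le_pow₀ hb1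
      nlinarith
    · refine ⟨⟨intWeight b (cellIndex b x) % 2, Nat.mod_lt _ two_pos⟩, _,
        ⟨_, cellPos b x, rfl, rfl⟩, rfl, ?_⟩
      exact linked_of_grid hb3 _ _ _ fun q hq => by
        rw [Set.uIcc_self, Set.mem_singleton_iff] at hq
        rw [hq]
    · exact sepFamily_linkedPiece X hb3 hr i
    · obtain ⟨i, d, a, _, rfl⟩ := Set.mem_iUnion.1 hU
      exact card_linkedPiece_le X hsep hb3 d a x s hs t ht
  · rintro ⟨C, hC, 𝒰, ⟨hcov, hU⟩, hgrow⟩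
    obtain ⟨U, hUm, hall⟩ := exists_piece_eq_univ X hmax (𝒰 0)
      (fun x => by
        obtain ⟨i, U, hU, hx⟩ := hcov x
        rw [show i = (0 : Fin 1) from Subsingleton.elim (α := Fin 1) i 0] at hU
        exact ⟨U, hU, hx⟩) (hU 0)
    exact not_quadratic_growth X hmax C hC fun x s hs t ht =>
      hgrow U (Set.mem_iUnion.2 ⟨0, hUm⟩) x s hs t fun y hy => ⟨hall y, ht hy⟩
end

section
/- Let X be a maximal 1-separated subset of the hyperbolic plane ℍ². For every d ∈ ℕ, ov-asdim_{poly(d)}(X) = 2. In particular the lower bound holds: there exists r > 0 such that for every decomposition X = X₀ ∪ X₁ in which each X_i is a disjoint union of subsets ('pieces') any two of which are at distance ≥ r, with 𝒴 the collection of all pieces, there exist s ≥ 1 and m ≥ 0 such that the collection {N^m_s(Y) : Y ∈ 𝒴} fails to have uniformly polynomial growth of degree d, i.e. for every C ≥ 1 there exist Y ∈ 𝒴, a point x, and R ≥ 0 with |N^m_s(Y) ∩ B(x, R)| > C·R^d + C. -/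
open Metric Set

/-! ### The triangulated half-plane lattice -/

/-- `q` follows `p` along one of the three positive directions of the triangular lattice. -/
def LatticeStep (p q : ℤ × ℕ) : Prop :=
  q = (p.1 + 1, p.2) ∨ q = (p.1, p.2 + 1) ∨ q = (p.1 + 1, p.2 + 1)

/-- Adjacency in the triangular lattice on `ℤ × ℕ`. -/
def LatticeAdj (p q : ℤ × ℕ) : Prop := LatticeStep p q ∨ LatticeStep q p

theorem LatticeAdj.symm {p q : ℤ × ℕ} (h : LatticeAdj p q) : LatticeAdj q p := Or.symm h

theorem exists_int_primitive (h : ℤ → ℤ) : ∃ H : ℤ → ℤ, ∀ i, H (i + 1) - H i = h i := by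
  refine ⟨fun i => Int.rec (fun n => ∑ k ∈ Finset.range n, h k)
    (fun n => -∑ k ∈ Finset.range (n + 1), h (-(k : ℤ) - 1)) i, fun i => ?_⟩
  rcases i with n | n
  · change (∑ k ∈ Finset.range (n + 1), h k) - ∑ k ∈ Finset.range n, h k = h n
    rw [Finset.sum_range_succ]; ring
  · rcases n with _ | n
    · change (∑ k ∈ Finset.range 0, h k) - -∑ k ∈ Finset.range 1, h (-(k : ℤ) - 1) = h (-1)
      simp
    · change (-∑ k ∈ Finset.range (n + 1), h (-(k : ℤ) - 1)) -
        -∑ k ∈ Finset.range (n + 1 + 1), h (-(k : ℤ) - 1) = h (Int.negSucc (n + 1))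
      rw [Finset.sum_range_succ _ (n + 1), Int.negSucc_eq]
      have : -((n + 1 : ℕ) : ℤ) - 1 = -(((n + 1 : ℕ) : ℤ) + 1) := by ring
      rw [this]; ring

/-- A cochain on the lattice that vanishes around every triangle is a gradient. -/
theorem exists_potential (c : ℤ × ℕ → ℤ × ℕ → ℤ) (hanti : ∀ p q, c p q = -c q p)
    (hclosed : ∀ p q w, LatticeAdj p q → LatticeAdj q w → LatticeAdj w p →
      c p q + c q w + c w p = 0) :
    ∃ φ : ℤ × ℕ → ℤ, ∀ p q, LatticeAdj p q → φ q - φ p = c p q := by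
  obtain ⟨H, hH⟩ := exists_int_primitive fun i => c (i, 0) (i + 1, 0)
  let φ : ℤ × ℕ → ℤ := fun p => H p.1 + ∑ l ∈ Finset.range p.2, c (p.1, l) (p.1, l + 1)
  have vert : ∀ i j, φ (i, j + 1) - φ (i, j) = c (i, j) (i, j + 1) := fun i j => by
    simp only [φ, Finset.sum_range_succ]; ring
  have lower : ∀ (i : ℤ) (j : ℕ), c (i, j) (i + 1, j) + c (i + 1, j) (i + 1, j + 1) +
      c (i + 1, j + 1) (i, j) = 0 := fun i j =>
    hclosed _ _ _ (.inl (.inl rfl)) (.inl (.inr (.inl rfl))) (.inr (.inr (.inr rfl)))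
  have upper : ∀ (i : ℤ) (j : ℕ), c (i, j) (i, j + 1) + c (i, j + 1) (i + 1, j + 1) +
      c (i + 1, j + 1) (i, j) = 0 := fun i j =>
    hclosed _ _ _ (.inl (.inr (.inl rfl))) (.inl (.inl rfl)) (.inr (.inr (.inr rfl)))
  have horiz : ∀ i j, φ (i + 1, j) - φ (i, j) = c (i, j) (i + 1, j) := by
    intro i j
    induction j with
    | zero => simpa [φ] using hH i
    | succ j ih =>
      have h1 := vert i j
      have h2 := vert (i + 1) j
      have h3 := lower i j
      have h4 := upper i j
      linarith
  have diag : ∀ i j, φ (i + 1, j + 1) - φ (i, j) = c (i, j) (i + 1, j + 1) := by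
    intro i j
    have h1 := vert i j
    have h2 := horiz i (j + 1)
    have h4 := upper i j
    have h5 := hanti (i, j) (i + 1, j + 1)
    linarith
  have step : ∀ p q, LatticeStep p q → φ q - φ p = c p q := by
    rintro ⟨i, j⟩ q (rfl | rfl | rfl)
    · exact horiz i j
    · exact vert i j
    · exact diag i j
  refine ⟨φ, fun p q h => h.elim (step p q) fun h => ?_⟩
  have h1 := step q p h
  have h2 := hanti p q
  linarith

/-- `p` and `q` are joined by a lattice path inside `S`. -/
def ChainIn (S : Set (ℤ × ℕ)) : ℤ × ℕ → ℤ × ℕ → Prop :=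
  Relation.ReflTransGen fun p q => LatticeAdj p q ∧ p ∈ S ∧ q ∈ S

theorem ChainIn.symm {S : Set (ℤ × ℕ)} {p q : ℤ × ℕ} (h : ChainIn S p q) : ChainIn S q p := by
  induction h with
  | refl => exact .refl
  | tail _ h ih => exact .head ⟨h.1.symm, h.2.2, h.2.1⟩ ih

theorem ChainIn.mono {S T : Set (ℤ × ℕ)} (hST : S ⊆ T) {p q : ℤ × ℕ} (h : ChainIn S p q) :
    ChainIn T p q := by
  induction h with
  | refl => exact .refl
  | tail _ h ih => exact ih.tail ⟨h.1, hST h.2.1, hST h.2.2⟩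

theorem ChainIn.mem {S : Set (ℤ × ℕ)} {p q : ℤ × ℕ} (h : ChainIn S p q) (hp : p ∈ S) :
    q ∈ S := by
  rcases Relation.ReflTransGen.cases_tail h with rfl | ⟨_, _, h⟩
  exacts [hp, h.2.2]

/-- A set of lattice points is connected. -/
def LatticeConnected (S : Set (ℤ × ℕ)) : Prop := ∀ p ∈ S, ∀ q ∈ S, ChainIn S p q

theorem ChainIn.connected (S : Set (ℤ × ℕ)) (p : ℤ × ℕ) :
    ∀ q, ChainIn S p q → ChainIn {u | ChainIn S p u} p q := by
  intro q h
  induction h with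
  | refl => exact .refl
  | tail h h' ih => exact ih.tail ⟨h'.1, h, h.tail h'⟩

theorem latticeConnected_component (S : Set (ℤ × ℕ)) (p : ℤ × ℕ) :
    LatticeConnected {u | ChainIn S p u} := fun u hu v hv =>
  (ChainIn.connected S p u hu).symm.trans (ChainIn.connected S p v hv)

theorem chainIn_row {S : Set (ℤ × ℕ)} (j : ℕ) {a b : ℤ} (hab : a ≤ b)
    (hS : ∀ t, a ≤ t → t ≤ b → (t, j) ∈ S) : ChainIn S (a, j) (b, j) := by
  induction b, hab using Int.leInduction with
  | base => exact .refl
  | succ b hab ih =>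
    exact (ih fun t h1 h2 => hS t h1 (by omega)).tail
      ⟨.inl (.inl rfl), hS b hab (by omega), hS (b + 1) (by omega) le_rfl⟩

theorem chainIn_column {S : Set (ℤ × ℕ)} (i : ℤ) {a b : ℕ} (hab : a ≤ b)
    (hS : ∀ t, a ≤ t → t ≤ b → (i, t) ∈ S) : ChainIn S (i, a) (i, b) := by
  induction b, hab using Nat.le_induction with
  | base => exact .refl
  | succ b hab ih =>
    exact (ih fun t h1 h2 => hS t h1 (by omega)).tail
      ⟨.inl (.inr (.inl rfl)), hS b hab (by omega), hS (b + 1) (by omega) le_rfl⟩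

/-- The step relation along the boundary of `W`: both points lie outside `W` and form a
triangle with a point of `W`. -/
def BoundaryStep (W : Set (ℤ × ℕ)) (u v : ℤ × ℕ) : Prop :=
  LatticeAdj u v ∧ u ∉ W ∧ v ∉ W ∧ ∃ w ∈ W, LatticeAdj u w ∧ LatticeAdj v w

theorem triangle_sum_eq_zero {A B C P Q R : Prop} [Decidable A] [Decidable B] [Decidable C]
    [Decidable P] [Decidable Q] [Decidable R] (n1 : A → ¬P) (n2 : B → ¬Q) (n3 : C → ¬R)
    (k1 : A → R → ¬Q → B) (k2 : A → Q → ¬R → C) (k3 : B → R → ¬P → A) (k4 : B → P → ¬R → C)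
    (k5 : C → P → ¬Q → B) (k6 : C → Q → ¬P → A) :
    ((if A ∧ Q then (1 : ℤ) else 0) - if B ∧ P then 1 else 0) +
      ((if B ∧ R then 1 else 0) - if C ∧ Q then 1 else 0) +
      ((if C ∧ P then 1 else 0) - if A ∧ R then 1 else 0) = 0 := by
  by_cases A <;> by_cases B <;> by_cases C <;> by_cases P <;> by_cases Q <;> by_cases R <;>
    simp_all

/-- If a connected set `W` has a gap on the bottom row, the two ends of the gap are joined
along the boundary of `W`. -/
theorem boundary_chain {W : Set (ℤ × ℕ)} (hW : LatticeConnected W) {a b : ℤ}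
    (ha : (a, 0) ∈ W) (hb : (b, 0) ∈ W) (hab : a + 2 ≤ b)
    (hgap : ∀ t, a < t → t < b → ((t, 0) : ℤ × ℕ) ∉ W) :
    Relation.ReflTransGen (BoundaryStep W) (a + 1, 0) (b - 1, 0) := by
  classical
  let Q : Set (ℤ × ℕ) := {u | Relation.ReflTransGen (BoundaryStep W) (a + 1, 0) u}
  have hu : ((a + 1, 0) : ℤ × ℕ) ∉ W := hgap _ (by omega) (by omega)
  have hQW : ∀ u ∈ Q, u ∉ W := by
    intro u h
    rcases Relation.ReflTransGen.cases_tail h with h | ⟨_, _, h⟩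
    · rw [h]; exact hu
    · exact h.2.2.1
  let χ : ℤ × ℕ → ℤ × ℕ → ℤ := fun p q => if p ∈ Q ∧ q ∈ W then 1 else 0
  have key : ∀ u w p, u ∈ Q → w ∈ W → p ∉ W → LatticeAdj u w → LatticeAdj u p →
      LatticeAdj p w → p ∈ Q := fun u w p h1 h2 h3 h4 h5 h6 =>
    Relation.ReflTransGen.tail h1 ⟨h5, hQW u h1, h3, w, h2, h4, h6⟩
  obtain ⟨φ, hφ⟩ := exists_potential (fun p q => χ p q - χ q p) (fun p q => by ring) (by
    intro p q w h1 h2 h3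
    have k1 := key p w q
    have k2 := key p q w
    have k3 := key q w p
    have k4 := key q p w
    have k5 := key w p q
    have k6 := key w q p
    exact triangle_sum_eq_zero (hQW p) (hQW q) (hQW w)
      (fun a b c => k1 a b c h3.symm h1 h2) (fun a b c => k2 a b c h1 h3.symm h2.symm)
      (fun a b c => k3 a b c h2 h1.symm h3.symm) (fun a b c => k4 a b c h1.symm h2 h3)
      (fun a b c => k5 a b c h3 h2.symm h1.symm) (fun a b c => k6 a b c h2.symm h3 h1))
  have hφW : ∀ p q, ChainIn W p q → φ p = φ q := by
    intro p q h
    induction h with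
    | refl => rfl
    | tail _ h ih =>
      have h1 := hφ _ _ h.1
      have h2 : ∀ x ∈ W, x ∉ Q := fun x hx hx' => hQW x hx' hx
      simp only [χ, h2 _ h.2.1, h2 _ h.2.2, false_and, if_false] at h1
      omega
  have hφc : ∀ p q, ChainIn Wᶜ p q → φ p = φ q := by
    intro p q h
    induction h with
    | refl => rfl
    | tail _ h ih =>
      have h1 := hφ _ _ h.1
      have h2 := h.2.1
      have h3 := h.2.2
      rw [Set.mem_compl_iff] at h2 h3
      simp only [χ, h2, h3, and_false, if_false] at h1
      omega
  have e1 := hφW _ _ (hW _ ha _ hb)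
  have e2 := hφc (a + 1, 0) (b - 1, 0)
    (chainIn_row 0 (by omega) fun t h1 h2 => hgap t (by omega) (by omega))
  have e3 := hφ (a + 1, 0) (a, 0) (.inr (.inl rfl))
  have e4 := hφ (b - 1, 0) (b, 0) (.inl (.inl (by simp)))
  have m1 : ((a + 1, 0) : ℤ × ℕ) ∈ Q := Relation.ReflTransGen.refl
  have m2 : ((a, 0) : ℤ × ℕ) ∉ Q := fun h => hQW _ h ha
  have m3 : ((b, 0) : ℤ × ℕ) ∉ Q := fun h => hQW _ h hb
  by_contra h
  have m4 : ((b - 1, 0) : ℤ × ℕ) ∉ Q := h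
  simp only [χ, m1, m2, m3, m4, ha, true_and, false_and, if_true, if_false] at e3 e4
  omega

/-! ### A grid in the upper half-plane -/

section

open UpperHalfPlane

/-- The grid points `3 i + 2 ^ j I` of the upper half-plane. -/
noncomputable def gridPt (p : ℤ × ℕ) : ℍ := ⟨⟨3 * p.1, 2 ^ p.2⟩, by positivity⟩

@[simp] theorem gridPt_re (p : ℤ × ℕ) : (gridPt p).re = 3 * p.1 := rfl

@[simp] theorem gridPt_im (p : ℤ × ℕ) : (gridPt p).im = 2 ^ p.2 := rfl

theorem dist_gridPt_row_le (i i' : ℤ) (j : ℕ) :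
    dist (gridPt (i, j)) (gridPt (i', j)) ≤ 3 * |(i : ℝ) - i'| / 2 ^ j := by
  refine (dist_le_dist_coe_div_sqrt _ _).trans_eq ?_
  have h : dist (gridPt (i, j) : ℂ) (gridPt (i', j)) = 3 * |(i : ℝ) - i'| := by
    rw [Complex.dist_of_im_eq (by rfl)]
    change dist (3 * (i : ℝ)) (3 * (i' : ℝ)) = _
    rw [Real.dist_eq, ← mul_sub, abs_mul, abs_of_pos (by norm_num : (0 : ℝ) < 3)]
  rw [h, gridPt_im, gridPt_im, Real.sqrt_mul_self (by positivity)]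

theorem dist_gridPt_column_le (i : ℤ) (j j' : ℕ) :
    dist (gridPt (i, j)) (gridPt (i, j')) ≤ |(j : ℝ) - j'| := by
  rw [dist_of_re_eq (by rfl), gridPt_im, gridPt_im, Real.log_pow, Real.log_pow, Real.dist_eq,
    ← sub_mul, abs_mul]
  refine mul_le_of_le_one_right (abs_nonneg _) ?_
  rw [abs_of_pos (Real.log_pos (by norm_num))]
  linarith [Real.log_two_lt_d9]

theorem dist_gridPt_le_of_adj {p q : ℤ × ℕ} (h : LatticeAdj p q) :
    dist (gridPt p) (gridPt q) ≤ 4 := by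
  have row : ∀ (i : ℤ) (j : ℕ), dist (gridPt (i, j)) (gridPt (i + 1, j)) ≤ 3 := fun i j => by
    refine (dist_gridPt_row_le _ _ _).trans (div_le_of_le_mul₀ (by positivity) (by norm_num) ?_)
    push_cast
    rw [sub_add_cancel_left, abs_neg, abs_one]
    linarith [one_le_pow₀ (n := j) (by norm_num : (1 : ℝ) ≤ 2)]
  have col : ∀ (i : ℤ) (j : ℕ), dist (gridPt (i, j)) (gridPt (i, j + 1)) ≤ 1 := fun i j => by
    refine (dist_gridPt_column_le _ _ _).trans ?_
    push_cast
    rw [sub_add_cancel_left, abs_neg, abs_one]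
  have step : ∀ p q, LatticeStep p q → dist (gridPt p) (gridPt q) ≤ 4 := by
    rintro ⟨i, j⟩ q (rfl | rfl | rfl)
    · linarith [row i j]
    · linarith [col i j]
    · linarith [row i j, col (i + 1) j,
        dist_triangle (gridPt (i, j)) (gridPt (i + 1, j)) (gridPt (i + 1, j + 1))]
  rcases h with h | h
  · exact step p q h
  · rw [dist_comm]; exact step q p h

/-- A box of lattice points around `w`, with bounded hyperbolic size depending on `n`. -/
def gridBox (n : ℕ) (w : ℤ × ℕ) : Set (ℤ × ℕ) :=
  {v | v.2 ≤ w.2 + n ∧ w.2 ≤ v.2 + n ∧ |v.1 - w.1| ≤ 2 ^ (w.2 + n)}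

theorem mem_gridBox_self (n : ℕ) (w : ℤ × ℕ) : w ∈ gridBox n w :=
  ⟨by omega, by omega, by simp⟩

theorem chainIn_gridBox {n : ℕ} {v w : ℤ × ℕ} (h : v ∈ gridBox n w) :
    ChainIn (gridBox n w) w v := by
  obtain ⟨i, j⟩ := v
  obtain ⟨i', j'⟩ := w
  obtain ⟨h1, h2, h3⟩ := h
  simp only at h1 h2 h3
  have hrow : ChainIn (gridBox n (i', j')) (i', j') (i, j') := by
    rcases le_total i i' with h | h
    · refine (chainIn_row (S := gridBox n (i', j')) j' h
        fun t ht ht' => ⟨by simp, by simp, ?_⟩).symm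
      simp only
      rw [abs_le] at h3 ⊢
      constructor <;> omega
    · refine chainIn_row j' h fun t ht ht' => ⟨by simp, by simp, ?_⟩
      simp only
      rw [abs_le] at h3 ⊢
      constructor <;> omega
  refine hrow.trans ?_
  rcases le_total j j' with h | h
  · exact (chainIn_column (S := gridBox n (i', j')) i h
      fun t ht ht' => ⟨by simp only; omega, by simp only; omega, h3⟩).symm
  · exact chainIn_column i h fun t ht ht' => ⟨by simp only; omega, by simp only; omega, h3⟩

theorem dist_gridPt_le_of_mem_gridBox {n : ℕ} {v w : ℤ × ℕ} (h : v ∈ gridBox n w) :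
    dist (gridPt v) (gridPt w) ≤ n + 3 * 2 ^ n := by
  obtain ⟨i, j⟩ := v
  obtain ⟨i', j'⟩ := w
  obtain ⟨h1, h2, h3⟩ := h
  simp only at h1 h2 h3
  have e1 := dist_gridPt_column_le i j j'
  have e2 := dist_gridPt_row_le i i' j'
  have e3 : |(j : ℝ) - j'| ≤ n := by
    rw [abs_le]
    have h1' : (j : ℝ) ≤ j' + n := by exact_mod_cast h1
    have h2' : (j' : ℝ) ≤ j + n := by exact_mod_cast h2
    constructor <;> linarith
  have e4 : 3 * |(i : ℝ) - i'| / 2 ^ j' ≤ 3 * 2 ^ n := by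
    have h3' : |(i : ℝ) - i'| ≤ 2 ^ (j' + n) := by exact_mod_cast h3
    rw [div_le_iff₀ (by positivity), mul_assoc, ← pow_add, add_comm n]
    linarith
  linarith [dist_triangle (gridPt (i, j)) (gridPt (i, j')) (gridPt (i', j'))]

theorem half_lt_log_two : (1 / 2 : ℝ) < Real.log 2 := by linarith [Real.log_two_gt_d9]

theorem exp_le_two_pow {D : ℝ} {n : ℕ} (h : 2 * D ≤ n) : Real.exp D ≤ 2 ^ n := by
  rw [← Real.exp_log (by positivity : (0 : ℝ) < 2 ^ n), Real.exp_le_exp, Real.log_pow]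
  nlinarith [half_lt_log_two, (Nat.cast_nonneg n : (0 : ℝ) ≤ n)]

theorem mem_gridBox_of_dist_le {n : ℕ} {v w : ℤ × ℕ} {D : ℝ}
    (h : dist (gridPt v) (gridPt w) ≤ D) (hD : 2 * D ≤ n) : v ∈ gridBox n w := by
  have h1 := (dist_log_im_le (gridPt v) (gridPt w)).trans h
  have h0 : 0 ≤ D := dist_nonneg.trans h
  rw [gridPt_im, gridPt_im, Real.log_pow, Real.log_pow, Real.dist_eq, ← sub_mul, abs_mul,
    abs_of_pos (Real.log_pos (by norm_num : (1 : ℝ) < 2))] at h1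
  have h2 : |(v.2 : ℝ) - w.2| ≤ n := by
    nlinarith [half_lt_log_two, abs_nonneg ((v.2 : ℝ) - w.2)]
  have h3 := dist_coe_le (gridPt v) (gridPt w)
  have h4 : |((v.1 - w.1 : ℤ) : ℝ)| ≤ 2 ^ (w.2 + n) := by
    have h5 := (Complex.abs_re_le_norm ((gridPt v : ℂ) - gridPt w)).trans
      ((dist_eq_norm (gridPt v : ℂ) (gridPt w)).symm.le.trans h3)
    have h6 : ((gridPt v : ℂ) - gridPt w).re = 3 * ((v.1 - w.1 : ℤ) : ℝ) := by
      change 3 * (v.1 : ℝ) - 3 * (w.1 : ℝ) = _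
      push_cast; ring
    rw [h6, abs_mul, abs_of_pos (by norm_num : (0 : ℝ) < 3), gridPt_im] at h5
    have h7 := (Real.exp_le_exp.2 h).trans (exp_le_two_pow hD)
    have h8 : (2 : ℝ) ^ w.2 * (Real.exp (dist (gridPt v) (gridPt w)) - 1) ≤ 2 ^ w.2 * 2 ^ n := by
      gcongr; linarith
    rw [pow_add]
    linarith [abs_nonneg ((v.1 - w.1 : ℤ) : ℝ)]
  rw [abs_le] at h2
  refine ⟨?_, ?_, by exact_mod_cast h4⟩
  · have : (v.2 : ℝ) ≤ w.2 + n := by linarith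
    exact_mod_cast this
  · have : (w.2 : ℝ) ≤ v.2 + n := by linarith
    exact_mod_cast this

/-! ### Visual distance -/

/-- The Cayley transform of `p` centred at `z`. -/
noncomputable def cayley (z p : ℍ) : ℂ := ((p : ℂ) - z) / (p - (starRingEnd ℂ) z)

theorem coe_sub_conj_ne_zero (p z : ℍ) : (p : ℂ) - (starRingEnd ℂ) z ≠ 0 := fun h => by
  have h1 := congrArg Complex.im h
  simp only [Complex.sub_im, Complex.conj_im, coe_im, Complex.zero_im] at h1
  linarith [p.im_pos, z.im_pos]

theorem dist_coe_conj_pos (p z : ℍ) : 0 < dist (p : ℂ) ((starRingEnd ℂ) z) := by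
  rw [dist_eq_norm]; exact norm_pos_iff.2 (coe_sub_conj_ne_zero p z)

theorem dist_cayley (z p q : ℍ) : dist (cayley z p) (cayley z q) =
    dist (p : ℂ) q * (2 * z.im) /
      (dist (p : ℂ) ((starRingEnd ℂ) z) * dist (q : ℂ) ((starRingEnd ℂ) z)) := by
  have h : cayley z p - cayley z q = ((p : ℂ) - q) * (z - (starRingEnd ℂ) z) /
      ((p - (starRingEnd ℂ) z) * (q - (starRingEnd ℂ) z)) := by
    have h1 := coe_sub_conj_ne_zero p z
    have h2 := coe_sub_conj_ne_zero q z
    rw [cayley, cayley]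
    field_simp
    ring
  have h2 : ‖(z : ℂ) - (starRingEnd ℂ) z‖ = 2 * z.im := by
    rw [Complex.sub_conj, norm_mul, Complex.norm_I, mul_one, Complex.norm_real, coe_im,
      Real.norm_of_nonneg (by linarith [z.im_pos])]
  rw [dist_eq_norm, h, norm_div, norm_mul, norm_mul, h2]
  simp only [dist_eq_norm]

theorem dist_cayley_eq_sinh (z p q : ℍ) : dist (cayley z p) (cayley z q) =
    Real.sinh (dist p q / 2) / (Real.cosh (dist p z / 2) * Real.cosh (dist q z / 2)) := by
  rw [dist_cayley, sinh_half_dist, cosh_half_dist, cosh_half_dist]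
  have hp := p.im_pos
  have hq := q.im_pos
  have hz := z.im_pos
  have d1 := dist_coe_conj_pos p z
  have d2 := dist_coe_conj_pos q z
  rw [Real.sqrt_mul hp.le, Real.sqrt_mul hp.le, Real.sqrt_mul hq.le]
  have s1 := Real.sqrt_pos.2 hp
  have s2 := Real.sqrt_pos.2 hq
  have s3 := Real.sqrt_pos.2 hz
  have s4 := Real.mul_self_sqrt hz.le
  field_simp
  rw [sq, s4]

/-- The constant in the decay of the visual size of short segments. -/
noncomputable def visualConst : ℝ := 4 * Real.sinh 3 * Real.exp 3

theorem visualConst_pos : 0 < visualConst := by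
  have : 0 < Real.sinh 3 := Real.sinh_pos_iff.2 (by norm_num)
  unfold visualConst; positivity

theorem dist_cayley_le {z p q : ℍ} (h : dist p q ≤ 6) :
    dist (cayley z p) (cayley z q) ≤ visualConst * Real.exp (-dist p z) := by
  have cosh_ge : ∀ t : ℝ, Real.exp t / 2 ≤ Real.cosh t := fun t => by
    rw [Real.cosh_eq]; linarith [Real.exp_pos (-t)]
  have h1 : Real.sinh (dist p q / 2) ≤ Real.sinh 3 := Real.sinh_le_sinh.2 (by linarith)
  have h2 := dist_triangle p q z
  have h3 : Real.exp (dist p z) * Real.exp (-3) / 4 ≤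
      Real.cosh (dist p z / 2) * Real.cosh (dist q z / 2) := by
    refine le_trans ?_ (mul_le_mul (cosh_ge _) (cosh_ge _) (by positivity) (Real.cosh_pos _).le)
    rw [div_mul_div_comm, ← Real.exp_add, ← Real.exp_add]
    have : Real.exp (dist p z + -3) ≤ Real.exp (dist p z / 2 + dist q z / 2) :=
      Real.exp_le_exp.2 (by linarith)
    linarith
  have h4 : 0 ≤ Real.sinh 3 := Real.sinh_nonneg_iff.2 (by norm_num)
  rw [dist_cayley_eq_sinh]
  refine (div_le_div₀ h4 h1 (by positivity) h3).trans_eq ?_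
  rw [visualConst, Real.exp_neg, Real.exp_neg]
  field_simp

theorem exists_finset_dist_le_sum {α β : Type*} [PseudoMetricSpace β] {r : α → α → Prop}
    {f : α → β} {b : α → ℝ} (hb : ∀ x, 0 ≤ b x) (hr : ∀ x y, r x y → dist (f x) (f y) ≤ b x)
    {x y : α} (h : Relation.ReflTransGen r x y) :
    ∃ t : Finset α, (∀ u ∈ t, ∃ v, r u v) ∧ (∀ u ∈ t, dist (f u) (f y) ≤ ∑ v ∈ t, b v) ∧
      dist (f x) (f y) ≤ ∑ v ∈ t, b v := by
  classical
  induction h using Relation.ReflTransGen.head_induction_on with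
  | refl => exact ⟨∅, by simp⟩
  | @head x z hxz _ ih =>
    obtain ⟨t, h1, h2, h3⟩ := ih
    by_cases hx : x ∈ t
    · exact ⟨t, h1, h2, h2 x hx⟩
    · have h4 : dist (f x) (f y) ≤ ∑ v ∈ insert x t, b v := by
        rw [Finset.sum_insert hx]
        linarith [dist_triangle (f x) (f z) (f y), hr x z hxz]
      refine ⟨insert x t, ?_, ?_, h4⟩
      · intro u hu
        rcases Finset.mem_insert.1 hu with rfl | hu
        exacts [⟨z, hxz⟩, h1 u hu]
      · intro u hu
        rcases Finset.mem_insert.1 hu with rfl | hu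
        · exact h4
        · rw [Finset.sum_insert hx]
          linarith [h2 u hu, hb x]

/-- The number of points of `S` in any ball of radius `R` is at most `C * R ^ d + C`. -/
def HasPolyBound {X : Type*} [MetricSpace X] (d : ℕ) (C : ℝ) (S : Set X) : Prop :=
  ∀ (x : X) (R : ℝ), 0 ≤ R → ∀ t : Finset X, ↑t ⊆ S ∩ closedBall x R →
    (t.card : ℝ) ≤ C * R ^ d + C

theorem HasPolyBound.mono {X : Type*} [MetricSpace X] {d : ℕ} {C : ℝ} {S T : Set X}
    (h : HasPolyBound d C T) (hST : S ⊆ T) : HasPolyBound d C S := fun x R hR t ht =>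
  h x R hR t (ht.trans (inter_subset_inter_left _ hST))

theorem summable_exp_mul_poly (d : ℕ) (C : ℝ) :
    Summable fun k : ℕ => Real.exp (-(k : ℝ)) * (C * ((k : ℝ) + 2) ^ d + C) := by
  have h1 : ∀ e : ℕ, Summable fun k : ℕ => (k : ℝ) ^ e * Real.exp (-k) := fun e => by
    simpa using Real.summable_pow_mul_exp_neg_nat_mul e one_pos
  have h2 : Summable fun k : ℕ => ((k + 2 : ℕ) : ℝ) ^ d * Real.exp (-((k + 2 : ℕ) : ℝ)) :=
    (summable_nat_add_iff 2).2 (h1 d)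
  refine ((h2.mul_left (C * Real.exp 2)).add ((h1 0).mul_left C)).congr fun k => ?_
  have : Real.exp (-((k + 2 : ℕ) : ℝ)) = Real.exp (-(k : ℝ)) * Real.exp (-2) := by
    rw [← Real.exp_add]; push_cast; ring_nf
  have h3 : Real.exp 2 * Real.exp (-2) = 1 := by rw [← Real.exp_add]; simp
  rw [this]
  push_cast
  linear_combination C * ((k : ℝ) + 2) ^ d * Real.exp (-(k : ℝ)) * h3

/-- In sets of uniformly polynomial growth, the far points contribute little to the sum of
`exp (-dist · z)`. -/
theorem exists_tail_bound {X : Set ℍ} (hmax : ∀ z : ℍ, ∃ x ∈ X, dist z x ≤ 1) (d : ℕ) (C : ℝ)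
    {ε : ℝ} (hε : 0 < ε) : ∃ M : ℝ, 0 ≤ M ∧ ∀ S : Set X, HasPolyBound d C S → ∀ (z : ℍ)
      (t : Finset X), ↑t ⊆ S → (∀ u ∈ t, M ≤ dist (u : ℍ) z) →
        ∑ u ∈ t, Real.exp (-dist (u : ℍ) z) < ε := by
  classical
  obtain ⟨s, hs⟩ := summable_iff_vanishing_norm.1 (summable_exp_mul_poly d C) ε hε
  refine ⟨(s.sup id + 1 : ℕ), by positivity, fun S hS z t htS htM => ?_⟩
  let k : X → ℕ := fun u => ⌊dist (u : ℍ) z⌋₊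
  have hdisj : Disjoint (t.image k) s := by
    rw [Finset.disjoint_left]
    intro i hi his
    obtain ⟨u, hu, rfl⟩ := Finset.mem_image.1 hi
    have h1 : s.sup id + 1 ≤ k u := Nat.le_floor (htM u hu)
    have h2 : k u ≤ s.sup id := Finset.le_sup (f := id) his
    omega
  refine lt_of_le_of_lt ?_ ((le_abs_self _).trans_lt (hs _ hdisj))
  rw [← Finset.sum_fiberwise_of_maps_to (t := t.image k) (g := k)
    fun u hu => Finset.mem_image_of_mem k hu]
  obtain ⟨x₀, hx₀, hzx⟩ := hmax z
  refine Finset.sum_le_sum fun i _ => ?_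
  have hcard := hS ⟨x₀, hx₀⟩ (i + 2) (by positivity) (t.filter (k · = i)) (by
    intro u hu
    obtain ⟨hut, rfl⟩ := Finset.mem_filter.1 (Finset.mem_coe.1 hu)
    refine ⟨htS hut, ?_⟩
    rw [mem_closedBall]
    change dist (u : ℍ) x₀ ≤ _
    linarith [dist_triangle (u : ℍ) z x₀, (Nat.lt_floor_add_one (dist (u : ℍ) z)).le])
  calc ∑ u ∈ t.filter (k · = i), Real.exp (-dist (u : ℍ) z)
      ≤ ∑ u ∈ t.filter (k · = i), Real.exp (-(i : ℝ)) := by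
        refine Finset.sum_le_sum fun u hu => Real.exp_le_exp.2 (neg_le_neg ?_)
        rw [← (Finset.mem_filter.1 hu).2]
        exact Nat.floor_le dist_nonneg
    _ = Real.exp (-(i : ℝ)) * (t.filter (k · = i)).card := by
        rw [Finset.sum_const, nsmul_eq_mul, mul_comm]
    _ ≤ _ := by gcongr

/-- A Morse-type lemma: a path of polynomial growth whose end points are far apart as seen
from `z` comes close to `z`. -/
theorem exists_chain_point_near {X : Set ℍ} (hmax : ∀ z : ℍ, ∃ x ∈ X, dist z x ≤ 1)
    {ξ : ℤ × ℕ → X} (hξ : ∀ p, dist (gridPt p) (ξ p) ≤ 1) (d : ℕ) (C : ℝ) {ε : ℝ}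
    (hε : 0 < ε) : ∃ M : ℝ, 0 ≤ M ∧ ∀ P : Set (ℤ × ℕ), HasPolyBound d C (ξ '' P) →
      ∀ p q, p ∈ P → ChainIn P p q → ∀ z : ℍ,
        ε ≤ dist (cayley z (gridPt p)) (cayley z (gridPt q)) →
          ∃ u ∈ P, dist (gridPt u) z ≤ M := by
  have hK := visualConst_pos
  obtain ⟨M, hM, hMS⟩ := exists_tail_bound hmax d C (ε := ε / (4 * visualConst)) (by positivity)
  refine ⟨M + 1, by linarith, fun P hP p q hp hpq z hz => ?_⟩
  by_contra! hfar
  have hfar' : ∀ u ∈ P, M ≤ dist (ξ u : ℍ) z := fun u hu => by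
    linarith [hfar u hu, hξ u, dist_triangle (gridPt u) (ξ u) z]
  have hq := hpq.mem hp
  have small : ∀ t : Finset X, ↑t ⊆ ξ '' P →
      ∑ u ∈ t, visualConst * Real.exp (-dist (u : ℍ) z) < ε / 4 := fun t ht => by
    have := hMS _ hP z t ht fun u hu => by
      obtain ⟨v, hv, rfl⟩ := ht hu
      exact hfar' v hv
    rw [← Finset.mul_sum]
    rw [lt_div_iff₀ (by positivity)] at this
    linarith
  have hend : ∀ u ∈ P, dist (cayley z (ξ u)) (cayley z (gridPt u)) < ε / 4 := fun u hu => by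
    have h1 := small {ξ u} (by simpa using mem_image_of_mem ξ hu)
    rw [Finset.sum_singleton] at h1
    refine (dist_cayley_le ?_).trans_lt h1
    rw [dist_comm]; linarith [hξ u]
  have hchain : Relation.ReflTransGen
      (fun x y : X => x ∈ ξ '' P ∧ dist (x : ℍ) y ≤ 6) (ξ p) (ξ q) := by
    refine Relation.ReflTransGen.lift ξ ?_ p q hpq
    refine fun u v h => ⟨mem_image_of_mem ξ h.2.1, ?_⟩
    have h1 := dist_triangle4 (ξ u : ℍ) (gridPt u) (gridPt v) (ξ v)
    have h2 := dist_gridPt_le_of_adj h.1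
    rw [dist_comm (ξ u : ℍ) (gridPt u)] at h1
    linarith [hξ u, hξ v]
  obtain ⟨t, ht, -, hsum⟩ := exists_finset_dist_le_sum
    (f := fun x : X => cayley z x) (b := fun x => visualConst * Real.exp (-dist (x : ℍ) z))
    (fun x => by positivity) (fun x y h => dist_cayley_le h.2) hchain
  have h1 := small t fun u hu => (ht u hu).choose_spec.1
  have h2 := dist_triangle4 (cayley z (gridPt p)) (cayley z (ξ p)) (cayley z (ξ q))
    (cayley z (gridPt q))
  rw [dist_comm (cayley z (gridPt p)) (cayley z (ξ p))] at h2
  linarith [hend p hp, hend q hq]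

end

/-! ### Enlarging lattice sets along pieces -/

theorem iterNbhd_subset_of_le {X : Type*} [MetricSpace X] (𝒴 : Set (Set X)) {s s' : ℝ}
    (h : s ≤ s') (m : ℕ) (Y : Set X) : iterNbhd 𝒴 s m Y ⊆ iterNbhd 𝒴 s' m Y := by
  induction m with
  | zero => exact subset_rfl
  | succ m ih =>
    refine sUnion_subset_sUnion ?_
    rintro Y' ⟨h1, x, hx, z, hz, hxz⟩
    exact ⟨h1, x, hx, z, ih hz, hxz.trans h⟩

section

open UpperHalfPlane

/-- Enlarge `W` to its `n`-boxes, then along the pieces of `𝒴` they meet. -/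
def latticeExt {X : Type*} (𝒴 : Set (Set X)) (ξ : ℤ × ℕ → X) (n : ℕ) (W : Set (ℤ × ℕ)) :
    Set (ℤ × ℕ) :=
  {u | ∃ w ∈ W, ∃ v ∈ gridBox n w, ∃ U ∈ 𝒴, ξ v ∈ U ∧ ChainIn (ξ ⁻¹' U) v u}

/-- Every point of `W` lies in a piece all of whose points adjacent to it belong to `W`. -/
def LatticeSaturated {X : Type*} (𝒴 : Set (Set X)) (ξ : ℤ × ℕ → X) (W : Set (ℤ × ℕ)) : Prop :=
  ∀ w ∈ W, ∃ V ∈ 𝒴, ξ w ∈ V ∧ ∀ u, LatticeAdj w u → ξ u ∈ V → u ∈ W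

section

variable {X : Type*} {𝒴 : Set (Set X)} {ξ : ℤ × ℕ → X}

theorem gridBox_subset_latticeExt (hcov : ∀ x, ∃ V ∈ 𝒴, x ∈ V) {n : ℕ} {W : Set (ℤ × ℕ)}
    {w : ℤ × ℕ} (hw : w ∈ W) : gridBox n w ⊆ latticeExt 𝒴 ξ n W := fun v hv => by
  obtain ⟨V, hV, hvV⟩ := hcov (ξ v)
  exact ⟨w, hw, v, hv, V, hV, hvV, .refl⟩

theorem subset_latticeExt (hcov : ∀ x, ∃ V ∈ 𝒴, x ∈ V) (n : ℕ) (W : Set (ℤ × ℕ)) :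
    W ⊆ latticeExt 𝒴 ξ n W := fun w hw =>
  gridBox_subset_latticeExt hcov hw (mem_gridBox_self n w)

theorem latticeConnected_latticeExt (hcov : ∀ x, ∃ V ∈ 𝒴, x ∈ V) {n : ℕ} {W : Set (ℤ × ℕ)}
    (hW : LatticeConnected W) : LatticeConnected (latticeExt 𝒴 ξ n W) := by
  have key : ∀ u ∈ latticeExt 𝒴 ξ n W, ∃ w ∈ W, ChainIn (latticeExt 𝒴 ξ n W) w u := by
    rintro u ⟨w, hw, v, hv, U, hU, hvU, hvu⟩
    refine ⟨w, hw, ((chainIn_gridBox hv).mono (gridBox_subset_latticeExt hcov hw)).trans ?_⟩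
    refine (ChainIn.connected _ _ _ hvu).mono ?_
    exact fun u' hu' => ⟨w, hw, v, hv, U, hU, hvU, hu'⟩
  intro u hu u' hu'
  obtain ⟨w, hw, h⟩ := key u hu
  obtain ⟨w', hw', h'⟩ := key u' hu'
  exact h.symm.trans (((hW w hw w' hw').mono (subset_latticeExt hcov n W)).trans h')

theorem latticeSaturated_latticeExt (n : ℕ) (W : Set (ℤ × ℕ)) :
    LatticeSaturated 𝒴 ξ (latticeExt 𝒴 ξ n W) := by
  rintro u ⟨w, hw, v, hv, U, hU, hvU, hvu⟩
  have hu : ξ u ∈ U := hvu.mem hvU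
  exact ⟨U, hU, hu, fun u' h1 h2 =>
    ⟨w, hw, v, hv, U, hU, hvU, Relation.ReflTransGen.tail hvu ⟨h1, hu, h2⟩⟩⟩

end

theorem dist_coe_le_of_dist_gridPt_le {X : Set ℍ} {ξ : ℤ × ℕ → X}
    (hξ : ∀ p, dist (gridPt p) (ξ p) ≤ 1) {p q : ℤ × ℕ} {D : ℝ}
    (h : dist (gridPt p) (gridPt q) ≤ D) : dist (ξ p) (ξ q) ≤ D + 2 := by
  have h1 := dist_triangle4 (ξ p : ℍ) (gridPt p) (gridPt q) (ξ q)
  rw [dist_comm (ξ p : ℍ) (gridPt p)] at h1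
  change dist (ξ p : ℍ) (ξ q) ≤ _
  linarith [hξ p, hξ q]

theorem latticeExt_iterNbhd {X : Set ℍ} {𝒴 : Set (Set X)} {ξ : ℤ × ℕ → X}
    (hξ : ∀ p, dist (gridPt p) (ξ p) ≤ 1) {n m : ℕ} {s s' : ℝ} (hs : s ≤ s')
    (hn : n + 3 * 2 ^ n + 2 ≤ s') {Y : Set X} {W : Set (ℤ × ℕ)}
    (hW : ∀ w ∈ W, ξ w ∈ iterNbhd 𝒴 s m Y) :
    ∀ u ∈ latticeExt 𝒴 ξ n W, ξ u ∈ iterNbhd 𝒴 s' (m + 1) Y := by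
  rintro u ⟨w, hw, v, hv, U, hU, hvU, hvu⟩
  refine ⟨U, ⟨hU, ξ v, hvU, ξ w, iterNbhd_subset_of_le 𝒴 hs m Y (hW w hw), ?_⟩, hvu.mem hvU⟩
  exact (dist_coe_le_of_dist_gridPt_le hξ (dist_gridPt_le_of_mem_gridBox hv)).trans hn

/-- With two colours, a chain along the boundary of a saturated set stays in a single piece. -/
theorem boundary_chain_piece {X : Set ℍ} {𝒰 : Fin 2 → Set (Set X)} (hdec : Decomp 1 7 𝒰)
    {ξ : ℤ × ℕ → X} (hξ : ∀ p, dist (gridPt p) (ξ p) ≤ 1) {W : Set (ℤ × ℕ)}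
    (hsat : LatticeSaturated (⋃ i, 𝒰 i) ξ W) {u v : ℤ × ℕ} (hu : u ∉ W)
    (h : Relation.ReflTransGen (BoundaryStep W) u v) :
    ∃ U ∈ ⋃ i, 𝒰 i, ξ u ∈ U ∧ ChainIn (ξ ⁻¹' U ∩ Wᶜ) u v := by
  have close : ∀ {p q}, LatticeAdj p q → dist (ξ p) (ξ q) < 7 := fun h => by
    linarith [dist_coe_le_of_dist_gridPt_le hξ (dist_gridPt_le_of_adj h)]
  induction h with
  | refl =>
    obtain ⟨i, U, hU, hx⟩ := hdec.1 (ξ u)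
    exact ⟨U, mem_iUnion.2 ⟨i, hU⟩, hx, .refl⟩
  | @tail v v' _ hstep ih =>
    obtain ⟨U, hU, huU, hch⟩ := ih
    obtain ⟨hadj, hv, hv', w, hw, h1, h2⟩ := hstep
    have hvU : ξ v ∈ U := (hch.mem ⟨huU, hu⟩).1
    obtain ⟨i', U', hU', hvU'⟩ := hdec.1 (ξ v')
    obtain ⟨V, hV, hwV, hVW⟩ := hsat w hw
    obtain ⟨i, hUi⟩ := mem_iUnion.1 hU
    obtain ⟨e, hVe⟩ := mem_iUnion.1 hV
    have same : ∀ {i : Fin 2} {A B : Set X} {p q : ℤ × ℕ}, A ∈ 𝒰 i → B ∈ 𝒰 i → ξ p ∈ A →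
        ξ q ∈ B → LatticeAdj p q → A = B := fun {i A B p q} hA hB hp hq hpq => by
      by_contra hne
      exact absurd (hdec.2 i A hA B hB hne _ hp _ hq) (not_le.2 (close hpq))
    have hie : i ≠ e := by
      rintro rfl
      exact hv (hVW v h1.symm (same hUi hVe hvU hwV h1 ▸ hvU))
    have hie' : i' ≠ e := by
      rintro rfl
      exact hv' (hVW v' h2.symm (same hU' hVe hvU' hwV h2 ▸ hvU'))
    have hii : i = i' := by omega
    subst hii
    have hUU := same hUi hU' hvU hvU' hadj
    subst hUU
    exact ⟨U, hU, huU, Relation.ReflTransGen.tail hch ⟨hadj, ⟨hvU, hv⟩, hvU', hv'⟩⟩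

theorem dist_gridPt_conj_le (a A : ℤ) (k : ℕ) :
    dist (gridPt (a, 0) : ℂ) ((starRingEnd ℂ) (gridPt (A, k))) ≤
      3 * |(a : ℝ) - A| + (1 + 2 ^ k) := by
  rw [dist_eq_norm]
  refine (Complex.norm_le_abs_re_add_abs_im _).trans_eq ?_
  have h1 : ((gridPt (a, 0) : ℂ) - (starRingEnd ℂ) (gridPt (A, k))).re = 3 * ((a : ℝ) - A) := by
    change 3 * (a : ℝ) - 3 * (A : ℝ) = _
    ring
  have h2 : ((gridPt (a, 0) : ℂ) - (starRingEnd ℂ) (gridPt (A, k))).im = 1 + 2 ^ k := by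
    change (2 : ℝ) ^ 0 - -(2 ^ k) = _
    ring
  rw [h1, h2, abs_mul, abs_of_pos (by norm_num : (0 : ℝ) < 3),
    abs_of_pos (by positivity : (0 : ℝ) < 1 + 2 ^ k)]

/-- Two bottom points on the two sides of `(A, k)` are far apart as seen from that point. -/
theorem one_fifth_le_dist_cayley {a b A : ℤ} {k : ℕ} (h1 : A - 2 ^ k ≤ a) (h2 : a ≤ A)
    (h3 : A + 2 ^ k ≤ b) : 1 / 5 ≤ dist (cayley (gridPt (A, k)) (gridPt (a, 0)))
      (cayley (gridPt (A, k)) (gridPt (b, 0))) := by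
  have h1' : (A : ℝ) - 2 ^ k ≤ a := by exact_mod_cast h1
  have h2' : (a : ℝ) ≤ A := by exact_mod_cast h2
  have h3' : (A : ℝ) + 2 ^ k ≤ b := by exact_mod_cast h3
  have hH : (1 : ℝ) ≤ 2 ^ k := one_le_pow₀ (by norm_num)
  have e1 := dist_gridPt_conj_le a A k
  have e2 := dist_gridPt_conj_le b A k
  rw [abs_of_nonpos (by linarith)] at e1
  rw [abs_of_nonneg (by linarith)] at e2
  have e3 : dist (gridPt (a, 0) : ℂ) (gridPt (b, 0)) = 3 * ((b : ℝ) - a) := by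
    rw [Complex.dist_of_im_eq (by rfl)]
    change dist (3 * (a : ℝ)) (3 * (b : ℝ)) = _
    rw [Real.dist_eq, abs_of_nonpos (by linarith)]; ring
  rw [dist_cayley, gridPt_im, e3, le_div_iff₀
    (mul_pos (dist_coe_conj_pos _ _) (dist_coe_conj_pos _ _))]
  have e4 := mul_le_mul (e1.trans (by linarith : _ ≤ 5 * (2 : ℝ) ^ k))
    (e2.trans (by linarith : _ ≤ 5 * ((b : ℝ) - a))) dist_nonneg (by positivity)
  nlinarith [mul_pos (by linarith : (0 : ℝ) < 2 ^ k) (by linarith : (0 : ℝ) < b - a)]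

/-- A point far from the foot `(t, 0)` of the column through `(t, k)` is far from the foot as
seen from `(t, k)`. -/
theorem le_dist_cayley_column {t : ℤ} {k : ℕ} {v : ℤ × ℕ} {c : ℝ} (hc : 0 < c)
    (h : c * 2 ^ k ≤ dist (gridPt (t, 0) : ℂ) (gridPt v)) :
    c / (c + 2) ≤ dist (cayley (gridPt (t, k)) (gridPt (t, 0)))
      (cayley (gridPt (t, k)) (gridPt v)) := by
  have hH : (1 : ℝ) ≤ 2 ^ k := one_le_pow₀ (by norm_num)
  have e1 := dist_gridPt_conj_le t t k
  rw [sub_self, abs_zero] at e1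
  have e2 := dist_triangle (gridPt v : ℂ) (gridPt (t, 0)) ((starRingEnd ℂ) (gridPt (t, k)))
  rw [dist_comm (gridPt v : ℂ) (gridPt (t, 0))] at e2
  set D := dist (gridPt (t, 0) : ℂ) (gridPt v)
  rw [dist_cayley, gridPt_im, div_le_div_iff₀ (by positivity)
    (mul_pos (dist_coe_conj_pos _ _) (dist_coe_conj_pos _ _))]
  have e4 := mul_le_mul (e1.trans (by linarith : _ ≤ 2 * (2 : ℝ) ^ k))
    (e2.trans (by linarith : _ ≤ D + 2 * (2 : ℝ) ^ k)) dist_nonneg (by positivity)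
  have e5 := mul_le_mul_of_nonneg_left e4 hc.le
  refine e5.trans ?_
  change _ ≤ D * (2 * 2 ^ k) * (c + 2)
  nlinarith

/-- A connected saturated set containing a large
neighbourhood of `(a + 2 ^ k, k)` visits the bottom row in between. -/
theorem exists_bottom_visit {X : Set ℍ} {𝒰 : Fin 2 → Set (Set X)} (hdec : Decomp 1 7 𝒰)
    {ξ : ℤ × ℕ → X} (hξ : ∀ p, dist (gridPt p) (ξ p) ≤ 1) {M : ℝ}
    (hM : ∀ U ∈ ⋃ i, 𝒰 i, ∀ P ⊆ ξ ⁻¹' U, ∀ p q, p ∈ P → ChainIn P p q → ∀ z : ℍ,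
      1 / 5 ≤ dist (cayley z (gridPt p)) (cayley z (gridPt q)) →
        ∃ u ∈ P, dist (gridPt u) z ≤ M)
    {W : Set (ℤ × ℕ)} (hW : LatticeConnected W) (hsat : LatticeSaturated (⋃ i, 𝒰 i) ξ W)
    {a b : ℤ} {k : ℕ} (ha : (a, 0) ∈ W) (hb : (b, 0) ∈ W) (hab : a + 2 ^ (k + 1) ≤ b)
    (hball : ∀ u, dist (gridPt u) (gridPt (a + 2 ^ k, k)) ≤ M → u ∈ W) :
    ∃ t : ℤ, a + 2 ^ k ≤ t ∧ t ≤ a + 2 ^ (k + 1) ∧ (t, 0) ∈ W := by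
  by_contra! hno
  have hpos : (1 : ℤ) ≤ 2 ^ k := one_le_pow₀ (by norm_num)
  have hpow : (2 : ℤ) ^ (k + 1) = 2 ^ k + 2 ^ k := by ring
  have hb' : a + 2 ^ (k + 1) < b := lt_of_le_of_ne hab fun h =>
    hno b (by omega) h.ge hb
  obtain ⟨l, ⟨hl1, hl2⟩, hl⟩ := Int.exists_greatest_of_bdd
    (P := fun t => t < a + 2 ^ k ∧ ((t, 0) : ℤ × ℕ) ∈ W) ⟨a + 2 ^ k, fun t ht => ht.1.le⟩
    ⟨a, by omega, ha⟩
  obtain ⟨r, ⟨hr1, hr2⟩, hr⟩ := Int.exists_least_of_bdd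
    (P := fun t => a + 2 ^ (k + 1) < t ∧ ((t, 0) : ℤ × ℕ) ∈ W)
    ⟨a + 2 ^ (k + 1), fun t ht => ht.1.le⟩ ⟨b, hb', hb⟩
  have hla : a ≤ l := hl a ⟨by omega, ha⟩
  have hgap : ∀ t, l < t → t < r → ((t, 0) : ℤ × ℕ) ∉ W := by
    intro t h1 h2 h3
    rcases lt_or_ge t (a + 2 ^ k) with h4 | h4
    · exact absurd (hl t ⟨h4, h3⟩) (not_le.2 h1)
    rcases lt_or_ge (a + 2 ^ (k + 1)) t with h5 | h5
    · exact absurd (hr t ⟨h5, h3⟩) (not_le.2 h2)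
    exact hno t h4 h5 h3
  have hout : ((l + 1, 0) : ℤ × ℕ) ∉ W := hgap _ (by omega) (by omega)
  obtain ⟨U, hU, hlU, hch⟩ := boundary_chain_piece hdec hξ hsat hout
    (boundary_chain hW hl2 hr2 (by omega) hgap)
  obtain ⟨u, ⟨-, hu⟩, hdist⟩ := hM U hU _ inter_subset_left _ _ ⟨hlU, hout⟩ hch
    (gridPt (a + 2 ^ k, k)) (one_fifth_le_dist_cayley (by omega) (by omega) (by omega))
  exact hu (hball u hdist)

end

/-! ### Counting visits to the bottom row -/

section

open UpperHalfPlane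

/-- A two-colour decomposition of a net of the hyperbolic plane, with pieces at distance `≥ 7`,
whose iterated neighbourhoods have uniformly polynomial growth of degree `d`. -/
structure PolyTwoColouring (X : Set ℍ) (d : ℕ) (𝒰 : Fin 2 → Set (Set X)) (ξ : ℤ × ℕ → X) :
    Prop where
  exists_near : ∀ z : ℍ, ∃ x ∈ X, dist z x ≤ 1
  decomp : Decomp 1 7 𝒰
  dist_le : ∀ p, dist (gridPt p) (ξ p) ≤ 1
  growth : ∀ s : ℝ, 1 ≤ s → ∀ m : ℕ, ∃ C : ℝ, 1 ≤ C ∧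
    ∀ Y ∈ ⋃ i, 𝒰 i, HasPolyBound d C (iterNbhd (⋃ i, 𝒰 i) s m Y)

/-- A connected set of lattice points inside an iterated neighbourhood of a piece. -/
def LatticeAdmissible {X : Type*} [MetricSpace X] (𝒴 : Set (Set X)) (ξ : ℤ × ℕ → X) (m : ℕ)
    (s : ℝ) (W : Set (ℤ × ℕ)) : Prop :=
  LatticeConnected W ∧ ∃ Y ∈ 𝒴, ∀ u ∈ W, ξ u ∈ iterNbhd 𝒴 s m Y

theorem sum_range_choose_eq (n l : ℕ) : ∑ j ∈ Finset.range l, j.choose n = l.choose (n + 1) := by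
  induction l with
  | zero => simp
  | succ l ih => rw [Finset.sum_range_succ, ih, Nat.choose_succ_succ', add_comm]

namespace PolyTwoColouring

variable {X : Set ℍ} {d : ℕ} {𝒰 : Fin 2 → Set (Set X)} {ξ : ℤ × ℕ → X}

theorem cover (H : PolyTwoColouring X d 𝒰 ξ) (x : X) : ∃ V ∈ ⋃ i, 𝒰 i, x ∈ V := by
  obtain ⟨i, V, hV, hx⟩ := H.decomp.1 x
  exact ⟨V, mem_iUnion.2 ⟨i, hV⟩, hx⟩

theorem exists_radius (H : PolyTwoColouring X d 𝒰 ξ) (m : ℕ) {s : ℝ} (hs : 1 ≤ s) {ε : ℝ}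
    (hε : 0 < ε) : ∃ M : ℝ, 0 ≤ M ∧ ∀ Y ∈ ⋃ i, 𝒰 i, ∀ P : Set (ℤ × ℕ),
      (∀ u ∈ P, ξ u ∈ iterNbhd (⋃ i, 𝒰 i) s m Y) → ∀ p q, p ∈ P → ChainIn P p q → ∀ z : ℍ,
        ε ≤ dist (cayley z (gridPt p)) (cayley z (gridPt q)) →
          ∃ u ∈ P, dist (gridPt u) z ≤ M := by
  obtain ⟨C, -, hC⟩ := H.growth s hs m
  obtain ⟨M, hM, h⟩ := exists_chain_point_near H.exists_near H.dist_le d C hε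
  exact ⟨M, hM, fun Y hY P hP => h P ((hC Y hY).mono (image_subset_iff.2 hP))⟩

theorem exists_ext_visit (H : PolyTwoColouring X d 𝒰 ξ) (D : ℝ) :
    ∃ n : ℕ, ∀ W, LatticeConnected W → ∀ (a b : ℤ) (k : ℕ), (a, 0) ∈ W → (b, 0) ∈ W →
      a + 2 ^ (k + 1) ≤ b → (∃ w ∈ W, dist (gridPt w) (gridPt (a + 2 ^ k, k)) ≤ D) →
        ∃ t : ℤ, a + 2 ^ k ≤ t ∧ t ≤ a + 2 ^ (k + 1) ∧
          (t, 0) ∈ latticeExt (⋃ i, 𝒰 i) ξ n W := by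
  obtain ⟨M, hM, h⟩ := H.exists_radius 0 le_rfl (by norm_num : (0 : ℝ) < 1 / 5)
  refine ⟨⌈2 * (M + D)⌉₊, fun W hW a b k ha hb hab hw => ?_⟩
  obtain ⟨w, hw, hwD⟩ := hw
  refine exists_bottom_visit H.decomp H.dist_le (fun U hU P hP => h U hU P hP)
    (latticeConnected_latticeExt H.cover hW) (latticeSaturated_latticeExt _ _)
    (subset_latticeExt H.cover _ _ ha) (subset_latticeExt H.cover _ _ hb) hab fun u hu => ?_
  refine gridBox_subset_latticeExt H.cover hw (mem_gridBox_of_dist_le (D := M + D) ?_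
    (Nat.le_ceil _))
  rw [dist_comm] at hwD
  linarith [dist_triangle (gridPt u) (gridPt (a + 2 ^ k, k)) (gridPt w)]

theorem admissible_ext (H : PolyTwoColouring X d 𝒰 ξ) {m : ℕ} {s : ℝ} {W : Set (ℤ × ℕ)}
    (hW : LatticeAdmissible (⋃ i, 𝒰 i) ξ m s W) (n : ℕ) :
    LatticeAdmissible (⋃ i, 𝒰 i) ξ (m + 1) (max s (n + 3 * 2 ^ n + 2))
      (latticeExt (⋃ i, 𝒰 i) ξ n W) := by
  obtain ⟨h1, Y, hY, h2⟩ := hW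
  exact ⟨latticeConnected_latticeExt H.cover h1, Y, hY,
    latticeExt_iterNbhd H.dist_le (le_max_left _ _) (le_max_right _ _) h2⟩

/-- Admissible sets with two distant bottom points can be enlarged so as to visit the bottom
row at least `l.choose n` times. -/
theorem exists_many_visits (H : PolyTwoColouring X d 𝒰 ξ) (n m : ℕ) (s : ℝ) (hs : 1 ≤ s) :
    ∃ (m' : ℕ) (s' : ℝ), 1 ≤ s' ∧ ∀ W, LatticeAdmissible (⋃ i, 𝒰 i) ξ m s W →
      ∃ W', LatticeAdmissible (⋃ i, 𝒰 i) ξ m' s' W' ∧ ∀ (a b : ℤ) (l : ℕ), (a, 0) ∈ W →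
        (b, 0) ∈ W → a + 4 ^ (l + n) ≤ b → ∃ F : Finset ℤ,
          (∀ t ∈ F, a ≤ t ∧ t < a + 4 ^ (l + n) ∧ (t, 0) ∈ W') ∧ l.choose n ≤ F.card := by
  induction n generalizing m s with
  | zero =>
    refine ⟨m, s, hs, fun W hW => ⟨W, hW, fun a b l ha _ _ => ⟨{a}, ?_, by simp⟩⟩⟩
    intro t ht
    rw [Finset.mem_singleton.1 ht]
    exact ⟨le_rfl, by simp, ha⟩
  | succ n ih =>
    obtain ⟨M, -, hM⟩ := H.exists_radius m hs (by norm_num : (0 : ℝ) < 1 / 5)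
    obtain ⟨n₀, hn₀⟩ := H.exists_ext_visit M
    obtain ⟨m', s', hs', hcount⟩ := ih (m + 1) (max s (n₀ + 3 * 2 ^ n₀ + 2))
      (hs.trans (le_max_left _ _))
    refine ⟨m', s', hs', fun W hW => ?_⟩
    obtain ⟨W', hW', hF⟩ := hcount _ (H.admissible_ext hW n₀)
    refine ⟨W', hW', fun a b l ha hb hab => ?_⟩
    obtain ⟨hconn, Y, hY, hWY⟩ := hW
    have main : ∀ j : ℕ, j < l → ∃ F : Finset ℤ, (∀ t ∈ F, a + 4 ^ (n + j) ≤ t ∧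
        t < a + 4 ^ (n + j + 1) ∧ (t, 0) ∈ W') ∧ j.choose n ≤ F.card := by
      intro j hj
      have hle : (4 : ℤ) ^ (n + j + 1) ≤ 4 ^ (l + (n + 1)) :=
        pow_le_pow_right₀ (by norm_num) (by omega)
      have hpos : (0 : ℤ) < 4 ^ (n + j) := by positivity
      have h4 : (4 : ℤ) ^ (n + j + 1) = 4 * 4 ^ (n + j) := by ring
      have h2 : (2 : ℤ) ^ (2 * (n + j)) = 4 ^ (n + j) := by rw [pow_mul]; norm_num
      have h2' : (2 : ℤ) ^ (2 * (n + j) + 1) = 2 * 4 ^ (n + j) := by rw [pow_succ, h2]; ring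
      obtain ⟨t, ht1, ht2, ht⟩ := hn₀ W hconn a b (2 * (n + j)) ha hb (by rw [h2']; omega)
        (hM Y hY W hWY (a, 0) (b, 0) ha (hconn _ ha _ hb) _ (one_fifth_le_dist_cayley
          (by omega) (by rw [h2]; omega) (by rw [h2]; omega)))
      rw [h2] at ht1
      rw [h2'] at ht2
      have h5 : (4 : ℤ) ^ (j + n) = 4 ^ (n + j) := by rw [add_comm]
      obtain ⟨F, hF1, hF2⟩ := hF t b j ht (subset_latticeExt H.cover _ _ hb) (by rw [h5]; omega)
      refine ⟨F, fun t' ht' => ?_, hF2⟩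
      obtain ⟨h6, h7, h8⟩ := hF1 t' ht'
      rw [h5] at h7
      exact ⟨by omega, by omega, h8⟩
    choose! F hF1 hF2 using main
    refine ⟨(Finset.range l).biUnion F, fun t ht => ?_, ?_⟩
    · obtain ⟨j, hj, ht⟩ := Finset.mem_biUnion.1 ht
      have hj' := Finset.mem_range.1 hj
      obtain ⟨h1, h2, h3⟩ := hF1 j hj' t ht
      have hle : (4 : ℤ) ^ (n + j + 1) ≤ 4 ^ (l + (n + 1)) :=
        pow_le_pow_right₀ (by norm_num) (by omega)
      have hpos : (0 : ℤ) < 4 ^ (n + j) := by positivity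
      exact ⟨by omega, by omega, h3⟩
    · have key : ∀ i j t, i < j → j < l → t ∈ F i → t ∉ F j := by
        intro i j t hij hj hi hj'
        have h1 := (hF1 i (hij.trans hj) t hi).2.1
        have h2 := (hF1 j hj t hj').1
        have h3 : (4 : ℤ) ^ (n + i + 1) ≤ 4 ^ (n + j) :=
          pow_le_pow_right₀ (by norm_num) (by omega)
        omega
      rw [Finset.card_biUnion, ← sum_range_choose_eq]
      · exact Finset.sum_le_sum fun j hj => hF2 j (Finset.mem_range.1 hj)
      · intro i hi j hj hij
        rw [Function.onFun, Finset.disjoint_left]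
        intro t h1 h2
        have hi := Finset.mem_range.1 (Finset.mem_coe.1 hi)
        have hj := Finset.mem_range.1 (Finset.mem_coe.1 hj)
        rcases lt_or_gt_of_ne hij with h | h
        · exact key i j t h hj h1 h2
        · exact key j i t h hi h2 h1

end PolyTwoColouring

/-- The lattice path going up from `(a, 0)`, across at height `k`, and down to `(b, 0)`. -/
def archPath (a b : ℤ) (k : ℕ) : Set (ℤ × ℕ) :=
  {v | v.1 = a ∧ v.2 ≤ k ∨ v.2 = k ∧ a ≤ v.1 ∧ v.1 ≤ b ∨ v.1 = b ∧ v.2 ≤ k}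

theorem latticeConnected_archPath {a b : ℤ} (hab : a ≤ b) (k : ℕ) :
    LatticeConnected (archPath a b k) := by
  have key : ∀ v ∈ archPath a b k, ChainIn (archPath a b k) (a, k) v := by
    have across : ∀ i, a ≤ i → i ≤ b → ChainIn (archPath a b k) (a, k) (i, k) := fun i h1 h2 =>
      chainIn_row k h1 fun t h3 h4 => .inr (.inl ⟨rfl, h3, h4.trans h2⟩)
    rintro ⟨i, j⟩ (⟨h1, h2⟩ | ⟨h1, h2, h3⟩ | ⟨h1, h2⟩)
    · simp only at h1 h2
      subst h1
      exact (chainIn_column i h2 fun t _ h => .inl ⟨rfl, h⟩).symm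
    · simp only at h1 h2 h3
      subst h1
      exact across i h2 h3
    · simp only at h1 h2
      subst h1
      exact (across i hab le_rfl).trans
        (chainIn_column i h2 fun t _ h => .inr (.inr ⟨rfl, h⟩)).symm
  exact fun u hu v hv => (key u hu).symm.trans (key v hv)

theorem le_dist_coe_of_mem_archPath {a t : ℤ} {k : ℕ} (h1 : a + 2 ^ k ≤ t)
    (h2 : t ≤ a + 2 ^ (k + 1)) {w : ℤ × ℕ} (hw : w ∈ archPath a (a + 2 ^ (k + 2)) k) :
    (2 : ℝ) ^ k - 1 ≤ dist (gridPt (t, 0) : ℂ) (gridPt w) := by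
  have h1' : (a : ℝ) + 2 ^ k ≤ t := by exact_mod_cast h1
  have h2' : (t : ℝ) ≤ a + 2 ^ (k + 1) := by exact_mod_cast h2
  have hH : (1 : ℝ) ≤ 2 ^ k := one_le_pow₀ (by norm_num)
  have hre : |3 * ((t : ℝ) - w.1)| ≤ dist (gridPt (t, 0) : ℂ) (gridPt w) := by
    rw [dist_eq_norm]
    refine le_trans (le_of_eq ?_) (Complex.abs_re_le_norm _)
    change _ = |3 * (t : ℝ) - 3 * (w.1 : ℝ)|
    rw [mul_sub]
  have him : |1 - (2 : ℝ) ^ w.2| ≤ dist (gridPt (t, 0) : ℂ) (gridPt w) := by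
    rw [dist_eq_norm]
    refine le_trans (le_of_eq ?_) (Complex.abs_im_le_norm _)
    change _ = |(2 : ℝ) ^ 0 - 2 ^ w.2|
    rw [pow_zero]
  rcases hw with ⟨h, -⟩ | ⟨h, -, -⟩ | ⟨h, -⟩
  · rw [h] at hre
    linarith [le_abs_self (3 * ((t : ℝ) - a))]
  · rw [h] at him
    linarith [neg_abs_le (1 - (2 : ℝ) ^ k)]
  · rw [h] at hre
    push_cast at hre
    have h3 : (2 : ℝ) ^ (k + 1) = 2 * 2 ^ k := by ring
    have h4 : (2 : ℝ) ^ (k + 2) = 4 * 2 ^ k := by ring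
    rw [h4] at hre
    rw [h3] at h2'
    linarith [neg_abs_le (3 * ((t : ℝ) - (a + 4 * 2 ^ k)))]

theorem eq_of_dist_gridPt_le_two {t t' : ℤ} (h : dist (gridPt (t, 0)) (gridPt (t', 0)) ≤ 2) :
    t = t' := by
  by_contra hne
  have h1 := sinh_half_dist (gridPt (t, 0)) (gridPt (t', 0))
  have h2 : dist (gridPt (t, 0) : ℂ) (gridPt (t', 0)) = 3 * |((t - t' : ℤ) : ℝ)| := by
    rw [Complex.dist_of_im_eq (by rfl)]
    change dist (3 * (t : ℝ)) (3 * (t' : ℝ)) = _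
    rw [Real.dist_eq, ← mul_sub, abs_mul, abs_of_pos (by norm_num : (0 : ℝ) < 3)]
    push_cast; rfl
  have h3 : (1 : ℝ) ≤ |((t - t' : ℤ) : ℝ)| := by
    exact_mod_cast Int.one_le_abs (sub_ne_zero.2 hne)
  rw [h2, gridPt_im, gridPt_im] at h1
  norm_num at h1
  have h4 : Real.sinh (dist (gridPt (t, 0)) (gridPt (t', 0)) / 2) ≤ Real.sinh 1 :=
    Real.sinh_le_sinh.2 (by linarith)
  rw [h1, Real.sinh_eq] at h4
  have h5 := Real.exp_one_lt_d9
  have h6 := Real.exp_pos (-1)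
  push_cast at h3
  linarith

namespace PolyTwoColouring

variable {X : Set ℍ} {d : ℕ} {𝒰 : Fin 2 → Set (Set X)} {ξ : ℤ × ℕ → X}

/-- Pieces climbing from a bottom point `(t, 0)` to the vicinity of `(t, k)`. -/
theorem exists_climbing_piece (H : PolyTwoColouring X d 𝒰 ξ) : ∃ (M : ℝ) (k₀ : ℕ), 0 ≤ M ∧
    ∀ k, k₀ ≤ k → ∀ a : ℤ, ∃ t : ℤ, a + 2 ^ k ≤ t ∧ t ≤ a + 2 ^ (k + 1) ∧
      ∃ U ∈ ⋃ i, 𝒰 i, ξ (t, 0) ∈ U ∧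
        ∃ u, ChainIn (ξ ⁻¹' U) (t, 0) u ∧ dist (gridPt u) (gridPt (t, k)) ≤ M := by
  obtain ⟨n, hn⟩ := H.exists_ext_visit 0
  set E : ℝ := Real.exp (n + 3 * 2 ^ n)
  have hE0 : 0 < E := Real.exp_pos _
  obtain ⟨k₀, hk₀⟩ := pow_unbounded_of_one_lt (2 * E) (by norm_num : (1 : ℝ) < 2)
  set c : ℝ := 1 / (2 * E) with hc
  have hc0 : 0 < c := by positivity
  obtain ⟨M, hM0, hM⟩ := H.exists_radius 0 le_rfl (by positivity : 0 < c / (c + 2))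
  refine ⟨M, k₀, hM0, fun k hk a => ?_⟩
  have hpow : (2 : ℤ) ^ (k + 2) = 4 * 2 ^ k := by ring
  have hpow' : (2 : ℤ) ^ (k + 1) = 2 * 2 ^ k := by ring
  have hpos : (0 : ℤ) < 2 ^ k := by positivity
  obtain ⟨t, ht1, ht2, w, hw, v, hv, U, hU, hvU, hch⟩ := hn (archPath a (a + 2 ^ (k + 2)) k)
    (latticeConnected_archPath (by omega) k) a (a + 2 ^ (k + 2)) k
    (.inl ⟨rfl, Nat.zero_le _⟩) (.inr (.inr ⟨rfl, Nat.zero_le _⟩)) (by omega)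
    ⟨(a + 2 ^ k, k), .inr (.inl ⟨rfl, by simp only; omega, by simp only; omega⟩), by simp⟩
  refine ⟨t, ht1, ht2, U, hU, hch.mem hvU, ?_⟩
  refine hM U hU {u | ChainIn (ξ ⁻¹' U) (t, 0) u}
    (fun u hu => ChainIn.mem hu (hch.mem hvU)) (t, 0) v .refl
    (ChainIn.connected _ _ _ hch.symm) _ (le_dist_cayley_column hc0 ?_)
  have hH : 2 * E ≤ 2 ^ k := hk₀.le.trans (pow_le_pow_right₀ (by norm_num) hk)
  have e1 := le_dist_coe_of_mem_archPath ht1 ht2 hw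
  have e2 := dist_triangle (gridPt (t, 0) : ℂ) (gridPt v) (gridPt w)
  have e3 := dist_coe_le (gridPt w) (gridPt v)
  rw [dist_comm (gridPt w : ℂ) (gridPt v), dist_comm (gridPt w) (gridPt v)] at e3
  have e4 : Real.exp (dist (gridPt v) (gridPt w)) ≤ E :=
    Real.exp_le_exp.2 (dist_gridPt_le_of_mem_gridBox hv)
  have e5 : (gridPt v).im ≤ dist (gridPt (t, 0) : ℂ) (gridPt v) + 1 := by
    have := (neg_le_abs _).trans (Complex.abs_im_le_norm ((gridPt (t, 0) : ℂ) - gridPt v))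
    rw [← dist_eq_norm] at this
    have h0 : ((gridPt (t, 0) : ℂ) - gridPt v).im = 1 - (gridPt v).im := by
      change (2 : ℝ) ^ 0 - _ = _
      rw [pow_zero]; rfl
    rw [h0] at this
    linarith
  have e6 : (gridPt v).im * (Real.exp (dist (gridPt v) (gridPt w)) - 1) ≤
      (dist (gridPt (t, 0) : ℂ) (gridPt v) + 1) * (E - 1) :=
    mul_le_mul e5 (by linarith) (by linarith [Real.one_le_exp (dist_nonneg (x := gridPt v)
      (y := gridPt w))]) (by positivity)
  rw [hc, div_mul_eq_mul_div, one_mul, div_le_iff₀ (by positivity)]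
  nlinarith

/-- There are admissible sets of bounded level with arbitrarily distant bottom points. -/
theorem exists_wide_admissible (H : PolyTwoColouring X d 𝒰 ξ) : ∃ s : ℝ, 1 ≤ s ∧ ∀ N : ℕ,
    ∃ W, LatticeAdmissible (⋃ i, 𝒰 i) ξ 1 s W ∧
      ∃ a b : ℤ, (a, 0) ∈ W ∧ (b, 0) ∈ W ∧ a + N ≤ b := by
  obtain ⟨M, k₀, hM, h⟩ := H.exists_climbing_piece
  set n : ℕ := ⌈2 * (2 * M + 18)⌉₊
  refine ⟨max 1 (n + 3 * 2 ^ n + 2), le_max_left _ _, fun N => ?_⟩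
  set k := max k₀ N
  obtain ⟨t, ht1, ht2, U, hU, htU, u, hu, hut⟩ := h k (le_max_left _ _) 0
  obtain ⟨t', ht1', ht2', U', hU', htU', u', hu', hut'⟩ := h k (le_max_left _ _) (2 ^ (k + 2))
  have hpow : (2 : ℤ) ^ (k + 2) = 4 * 2 ^ k := by ring
  have hpow' : (2 : ℤ) ^ (k + 1) = 2 * 2 ^ k := by ring
  have hpos : (0 : ℤ) < 2 ^ k := by positivity
  have hNk : (N : ℤ) ≤ 2 ^ k := by
    have h1 : N ≤ 2 ^ k := (le_max_right k₀ N).trans Nat.lt_two_pow_self.le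
    exact_mod_cast h1
  have hadm : LatticeAdmissible (⋃ i, 𝒰 i) ξ 0 1 {v | ChainIn (ξ ⁻¹' U) (t, 0) v} :=
    ⟨latticeConnected_component _ _, U, hU, fun v hv => ChainIn.mem hv htU⟩
  refine ⟨_, H.admissible_ext hadm n, t, t', subset_latticeExt H.cover _ _ .refl,
    ⟨u, hu, u', ?_, U', hU', hu'.mem htU', hu'.symm⟩, by omega⟩
  refine mem_gridBox_of_dist_le (D := 2 * M + 18) ?_ (Nat.le_ceil _)
  have e1 : dist (gridPt (t', k)) (gridPt (t, k)) ≤ 18 := by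
    refine (dist_gridPt_row_le _ _ _).trans ((div_le_iff₀ (by positivity)).2 ?_)
    have : |t' - t| ≤ 6 * 2 ^ k := by rw [abs_le]; constructor <;> omega
    have : |(t' : ℝ) - t| ≤ 6 * 2 ^ k := by exact_mod_cast this
    linarith
  have e2 := dist_triangle4 (gridPt u') (gridPt (t', k)) (gridPt (t, k)) (gridPt u)
  rw [dist_comm (gridPt (t, k)) (gridPt u)] at e2
  linarith

theorem choose_le (H : PolyTwoColouring X d 𝒰 ξ) : ∃ C : ℝ, 1 ≤ C ∧ ∀ l : ℕ,
    (l.choose (d + 1) : ℝ) ≤ C * (4 * (l + (d + 1) : ℕ) + 5) ^ d + C := by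
  classical
  obtain ⟨s, hs, hwide⟩ := H.exists_wide_admissible
  obtain ⟨m', s', hs', hcount⟩ := H.exists_many_visits (d + 1) 1 s hs
  obtain ⟨C, hC1, hC⟩ := H.growth s' hs' m'
  refine ⟨C, hC1, fun l => ?_⟩
  obtain ⟨W, hW, a, b, ha, hb, hab⟩ := hwide (4 ^ (l + (d + 1)))
  obtain ⟨W', ⟨-, Y, hY, hWY⟩, hF⟩ := hcount W hW
  obtain ⟨F, hF1, hF2⟩ := hF a b l ha hb (by exact_mod_cast hab)
  set K := l + (d + 1)
  have hinj : Function.Injective fun t : ℤ => ξ (t, 0) := by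
    intro t t' h
    refine eq_of_dist_gridPt_le_two ?_
    have h1 := H.dist_le (t, 0)
    have h2 := H.dist_le (t', 0)
    have h3 := dist_triangle_right (gridPt (t, 0)) (gridPt (t', 0)) (ξ (t, 0))
    rw [← show ξ (t, 0) = ξ (t', 0) from h] at h2
    linarith
  have hcard := hC Y hY (ξ (a, 0)) (4 * K + 5) (by positivity) (F.image fun t => ξ (t, 0)) (by
    intro x hx
    obtain ⟨t, ht, rfl⟩ := Finset.mem_image.1 (Finset.mem_coe.1 hx)
    obtain ⟨h1, h2, h3⟩ := hF1 t ht
    refine ⟨hWY _ h3, ?_⟩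
    rw [mem_closedBall]
    have e1 := dist_gridPt_column_le t 0 (2 * K)
    have e2 := dist_gridPt_row_le t a (2 * K)
    have e3 := dist_gridPt_column_le a (2 * K) 0
    have e4 : |(((0 : ℕ) : ℝ)) - ((2 * K : ℕ) : ℝ)| = 2 * K := by
      rw [abs_sub_comm, abs_of_nonneg] <;> push_cast <;> simp
    have e5 : 3 * |(t : ℝ) - a| / 2 ^ (2 * K) ≤ 3 := by
      have h1' : (a : ℝ) ≤ t := by exact_mod_cast h1
      have h2' : (t : ℝ) < a + 4 ^ K := by exact_mod_cast h2
      have h4 : (2 : ℝ) ^ (2 * K) = 4 ^ K := by rw [pow_mul]; norm_num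
      rw [div_le_iff₀ (by positivity), abs_of_nonneg (by linarith), h4]
      linarith
    rw [abs_sub_comm] at e3
    rw [e4] at e1 e3
    have e6 := dist_triangle4 (gridPt (t, 0)) (gridPt (t, 2 * K)) (gridPt (a, 2 * K))
      (gridPt (a, 0))
    refine (dist_coe_le_of_dist_gridPt_le H.dist_le (D := 4 * K + 3) ?_).trans ?_ <;> linarith)
  rw [Finset.card_image_of_injective _ hinj] at hcard
  exact le_trans (by exact_mod_cast hF2) hcard

theorem elim (H : PolyTwoColouring X d 𝒰 ξ) : False := by
  obtain ⟨C, hC, h⟩ := H.choose_le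
  set B : ℝ := (d + 1).factorial * (C * ((8 * d + 13) ^ d + 1)) with hB
  obtain ⟨j, hj⟩ := exists_nat_gt (max B 1)
  have hj1 : (1 : ℝ) ≤ j := (le_max_right _ _).trans hj.le
  have hjB : B < j := (le_max_left _ _).trans_lt hj
  have h1 := h (j + d)
  have h2 := Nat.pow_le_choose (α := ℝ) (d + 1) (j + d)
  rw [show j + d + 1 - (d + 1) = j by omega, div_le_iff₀ (by positivity)] at h2
  have h3 : (4 * ((j + d + (d + 1) : ℕ) : ℝ) + 5) ≤ (8 * d + 13) * j := by
    push_cast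
    nlinarith [(Nat.cast_nonneg d : (0 : ℝ) ≤ d)]
  have h4 : (4 * ((j + d + (d + 1) : ℕ) : ℝ) + 5) ^ d ≤ (8 * d + 13) ^ d * (j : ℝ) ^ d := by
    rw [← mul_pow]
    gcongr
  have h5 : (1 : ℝ) ≤ (j : ℝ) ^ d := one_le_pow₀ hj1
  have h6 : ((j + d).choose (d + 1) : ℝ) ≤ C * ((8 * d + 13) ^ d + 1) * (j : ℝ) ^ d := by
    refine h1.trans ?_
    nlinarith
  have h7 : (j : ℝ) ^ (d + 1) ≤ B * (j : ℝ) ^ d := by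
    rw [hB]
    have := mul_le_mul_of_nonneg_right h6 (by positivity : (0 : ℝ) ≤ (d + 1).factorial)
    linarith
  rw [pow_succ] at h7
  nlinarith

end PolyTwoColouring

end

/-! ### A decomposition into bounded pieces with three colours -/

section

open UpperHalfPlane

/-- Separated nets of the hyperbolic plane have bounded geometry. -/
theorem bddGeom_of_separated {X : Set ℍ} (hsep : ∀ x ∈ X, ∀ y ∈ X, x ≠ y → 1 ≤ dist x y) :
    BddGeom X := by
  classical
  intro R
  set N : ℤ := ⌈4 * Real.exp (2 * R)⌉
  refine ⟨(Finset.Icc (-N) N ×ˢ Finset.Icc (-N) N).card, fun x t ht => ?_⟩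
  have hx := (x : ℍ).im_pos
  set δ : ℝ := (x : ℍ).im * Real.exp (-R) / 4 with hδ
  have hδ0 : 0 < δ := by positivity
  have hδR : (x : ℍ).im * Real.exp R / δ = 4 * Real.exp (2 * R) := by
    have : Real.exp (2 * R) * Real.exp (-R) = Real.exp R := by rw [← Real.exp_add]; ring_nf
    rw [hδ, div_eq_iff hδ0.ne', ← this]; ring
  have bounds : ∀ y ∈ t, |(y : ℍ).re - (x : ℍ).re| ≤ (x : ℍ).im * Real.exp R ∧
      (y : ℍ).im ≤ (x : ℍ).im * Real.exp R ∧ (x : ℍ).im * Real.exp (-R) ≤ (y : ℍ).im := by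
    intro y hy
    have hd : dist (y : ℍ) x ≤ R := ht hy
    have hexp := Real.exp_le_exp.2 hd
    refine ⟨?_, ?_, ?_⟩
    · have h1 := Complex.abs_re_le_norm ((y : ℂ) - (x : ℍ))
      rw [← dist_eq_norm] at h1
      refine (h1.trans (dist_coe_le _ _)).trans ?_
      gcongr
      linarith
    · refine (im_le_im_mul_exp_dist (y : ℍ) x).trans ?_
      gcongr
    · have h1 := im_le_im_mul_exp_dist (x : ℍ) y
      rw [dist_comm] at h1
      have h2 : (x : ℍ).im ≤ (y : ℍ).im * Real.exp R := h1.trans (by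
        have := (y : ℍ).im_pos
        gcongr)
      rw [Real.exp_neg, ← div_eq_mul_inv, div_le_iff₀ (Real.exp_pos _)]
      exact h2
  have floor_mem : ∀ c : ℝ, |c| ≤ (x : ℍ).im * Real.exp R → ⌊c / δ⌋ ∈ Finset.Icc (-N) N := by
    intro c hc
    have h1 : |c / δ| ≤ 4 * Real.exp (2 * R) := by
      rw [abs_div, abs_of_pos hδ0, ← hδR]
      gcongr
    have h2 := abs_le.1 (h1.trans (Int.le_ceil _))
    rw [Finset.mem_Icc]
    constructor
    · rw [Int.le_floor]; push_cast; exact h2.1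
    · have := (Int.floor_le (c / δ)).trans h2.2
      exact_mod_cast this
  have near : ∀ a b : ℝ, ⌊a / δ⌋ = ⌊b / δ⌋ → |a - b| < δ := fun a b h => by
    have := Int.abs_sub_lt_one_of_floor_eq_floor h
    rwa [← sub_div, abs_div, abs_of_pos hδ0, div_lt_one hδ0] at this
  refine Finset.card_le_card_of_injOn
    (fun y : X => (⌊((y : ℍ).re - (x : ℍ).re) / δ⌋, ⌊(y : ℍ).im / δ⌋)) ?_ ?_
  · intro y hy
    obtain ⟨h1, h2, -⟩ := bounds y hy
    refine Finset.mem_coe.2 (Finset.mem_product.2 ⟨floor_mem _ h1, floor_mem _ ?_⟩)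
    rwa [abs_of_pos (y : ℍ).im_pos]
  · intro y hy y' hy' h
    by_contra hne
    have hsep1 := hsep y y.2 y' y'.2 fun h => hne (Subtype.ext h)
    obtain ⟨-, -, h1⟩ := bounds y hy
    obtain ⟨-, -, h2⟩ := bounds y' hy'
    have h3 := near _ _ (congrArg Prod.fst h)
    have h4 := near _ _ (congrArg Prod.snd h)
    rw [sub_sub_sub_cancel_right] at h3
    have h5 : dist (y : ℂ) (y' : ℍ) ≤ 2 * δ := by
      rw [dist_eq_norm]
      refine (Complex.norm_le_abs_re_add_abs_im _).trans ?_
      change |(y : ℍ).re - (y' : ℍ).re| + |(y : ℍ).im - (y' : ℍ).im| ≤ _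
      linarith
    have h6 : 4 * δ ≤ √((y : ℍ).im * (y' : ℍ).im) := by
      refine Real.le_sqrt_of_sq_le ?_
      rw [sq, hδ, mul_div_cancel₀ _ (by norm_num)]
      exact mul_le_mul h1 h2 (by positivity) (y : ℍ).im_pos.le
    have h7 := dist_le_dist_coe_div_sqrt (y : ℍ) y'
    have h8 : dist (y : ℂ) (y' : ℍ) / √((y : ℍ).im * (y' : ℍ).im) < 1 := by
      rw [div_lt_one (by linarith)]
      linarith
    linarith

/-- Bricks of width comparable to `l ^ 3` in the strip `l ^ (J - 1) ≤ im < l ^ (J + 1)`. -/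
def brick (l : ℝ) (J n : ℤ) : Set ℍ :=
  {z | l ^ (J - 1) ≤ z.im ∧ z.im < l ^ (J + 1) ∧
    (4 * l ^ 3 * (n - 1 / 2) + l ^ 2) * l ^ J ≤ z.re ∧
    z.re ≤ (4 * l ^ 3 * (n + 1 / 2) - l ^ 2) * l ^ J}

theorem exists_centred_or_near {P : ℝ} (hP : 0 < P) (g u : ℝ) :
    (∃ n : ℤ, P * (n - 1 / 2) + g ≤ u ∧ u ≤ P * (n + 1 / 2) - g) ∨
      ∃ c : ℤ, |u - P * (c + 1 / 2)| < g := by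
  have h1 := Int.floor_le (u / P + 1 / 2)
  have h2 := Int.lt_floor_add_one (u / P + 1 / 2)
  set n := ⌊u / P + 1 / 2⌋
  have h1' : P * (n - 1 / 2) ≤ u := by
    rw [mul_comm, ← le_div_iff₀ hP]; linarith
  have h2' : u < P * (n + 1 / 2) := by
    rw [mul_comm, ← div_lt_iff₀ hP]; linarith
  by_cases h3 : P * (n - 1 / 2) + g ≤ u
  · by_cases h4 : u ≤ P * (n + 1 / 2) - g
    · exact .inl ⟨n, h3, h4⟩
    · exact .inr ⟨n, abs_lt.2 ⟨by linarith, by linarith⟩⟩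
  · refine .inr ⟨n - 1, ?_⟩
    push_cast
    exact abs_lt.2 ⟨by nlinarith, by nlinarith⟩

theorem exists_mem_brick {h : ℤ} (hh : 1 ≤ h) (z : ℍ) :
    ∃ J n : ℤ, z ∈ brick (2 * h) J n := by
  have hh' : (1 : ℝ) ≤ h := by exact_mod_cast hh
  set l : ℝ := 2 * h with hl
  have hl2 : 2 ≤ l := by linarith
  have hl0 : 0 < l := by linarith
  obtain ⟨j, hj1, hj2⟩ := exists_mem_Ico_zpow z.im_pos (by linarith : 1 < l)
  have hmono : ∀ {a b : ℤ}, a ≤ b → l ^ a ≤ l ^ b := fun h =>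
    zpow_le_zpow_right₀ (by linarith) h
  have hP : 0 < 4 * l ^ 3 := by positivity
  have hj0 : 0 < l ^ j := zpow_pos hl0 j
  rcases exists_centred_or_near hP (l ^ 2) (z.re / l ^ j) with ⟨n, h1, h2⟩ | ⟨c, hc⟩
  · rw [le_div_iff₀ hj0] at h1
    rw [div_le_iff₀ hj0] at h2
    exact ⟨j, n, (hmono (by omega)).trans hj1, hj2, h1, h2⟩
  have hj0' : 0 < l ^ (j + 1) := zpow_pos hl0 _
  rcases exists_centred_or_near hP (l ^ 2) (z.re / l ^ (j + 1)) with ⟨n, h1, h2⟩ | ⟨c', hc'⟩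
  · rw [le_div_iff₀ hj0'] at h1
    rw [div_le_iff₀ hj0'] at h2
    exact ⟨j + 1, n, (hmono (by omega)).trans hj1, hj2.trans_le (hmono (by omega)), h1, h2⟩
  exfalso
  have e1 : z.re / l ^ j = l * (z.re / l ^ (j + 1)) := by
    rw [zpow_add_one₀ hl0.ne']; field_simp
  set u := z.re / l ^ (j + 1)
  rw [e1] at hc
  have e2 : |l * u - 4 * l ^ 3 * (l * c' + h)| < l ^ 3 := by
    have : l * u - 4 * l ^ 3 * (l * c' + h) = l * (u - 4 * l ^ 3 * (c' + 1 / 2)) := by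
      rw [hl]; ring
    rw [this, abs_mul, abs_of_pos hl0]
    nlinarith
  have e3 : |4 * l ^ 3 * ((l * c' + h) - (c + 1 / 2))| < l ^ 3 + l ^ 2 := by
    rw [abs_lt] at hc e2 ⊢
    constructor <;> linarith [hc.1, hc.2, e2.1, e2.2]
  have e4 : 1 / 2 ≤ |(l * c' + h) - (c + 1 / 2)| := by
    have h1 : (l * c' + h) - (c + 1 / 2) = ((2 * (2 * h * c' + h - c) - 1 : ℤ) : ℝ) / 2 := by
      push_cast; rw [hl]; ring
    rw [h1, abs_div, abs_of_pos (by norm_num : (0 : ℝ) < 2)]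
    have h2 : (1 : ℤ) ≤ |2 * (2 * h * c' + h - c) - 1| := Int.one_le_abs (by omega)
    have h3 : (1 : ℝ) ≤ |((2 * (2 * h * c' + h - c) - 1 : ℤ) : ℝ)| := by exact_mod_cast h2
    linarith
  rw [abs_mul, abs_of_pos hP] at e3
  nlinarith [mul_le_mul_of_nonneg_left e4 hP.le, pow_pos hl0 2]

theorem le_dist_brick_row {l r : ℝ} (hl : 1 ≤ l) (hr : Real.exp r ≤ l) {J n n' : ℤ}
    (hn : n < n') {z w : ℍ} (hz : z ∈ brick l J n) (hw : w ∈ brick l J n') :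
    r ≤ dist z w := by
  have hl0 : 0 < l := by linarith
  obtain ⟨-, -, -, hz⟩ := hz
  obtain ⟨-, hw1, hw2, -⟩ := hw
  have hJ : 0 < l ^ J := zpow_pos hl0 J
  rw [zpow_add_one₀ hl0.ne'] at hw1
  have hn' : (n : ℝ) + 1 ≤ n' := by exact_mod_cast hn
  have h1 : 2 * l ^ 2 * l ^ J ≤ w.re - z.re := by
    have : 0 ≤ 4 * l ^ 3 * (n' - (n + 1)) * l ^ J := by
      have : (0 : ℝ) ≤ n' - (n + 1) := by linarith
      positivity
    nlinarith
  have h2 : w.re - z.re ≤ dist (z : ℂ) w := by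
    rw [dist_eq_norm, norm_sub_rev]
    exact (le_abs_self _).trans (Complex.abs_re_le_norm ((w : ℂ) - z))
  have h3 := h1.trans (h2.trans (dist_coe_le z w))
  by_contra! h
  have h4 : Real.exp (dist z w) - 1 ≤ l := by linarith [Real.exp_le_exp.2 h.le]
  have h5 : 0 ≤ Real.exp (dist z w) - 1 := by
    linarith [Real.one_le_exp (dist_nonneg (x := z) (y := w))]
  have h6 := mul_le_mul hw1.le h4 h5 (by positivity)
  have h7 : 0 < l ^ J * l * l := by positivity
  nlinarith

theorem le_dist_brick_level {l r : ℝ} (hl : 1 ≤ l) (hr : Real.exp r ≤ l) {J J' n n' : ℤ}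
    (hJ : J + 3 ≤ J') {z w : ℍ} (hz : z ∈ brick l J n) (hw : w ∈ brick l J' n') :
    r ≤ dist z w := by
  have hl0 : 0 < l := by linarith
  have h1 : l ^ (J + 1) * l ≤ w.im := by
    rw [← zpow_add_one₀ hl0.ne']
    exact (zpow_le_zpow_right₀ hl (by omega)).trans hw.1
  have h2 := im_le_im_mul_exp_dist w z
  rw [dist_comm] at h2
  have h3 : z.im * l ≤ z.im * Real.exp (dist z w) := by
    nlinarith [hz.2.1]
  exact Real.exp_le_exp.1 (hr.trans (le_of_mul_le_mul_left h3 z.im_pos))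

theorem dist_le_of_mem_brick {l : ℝ} (hl : 1 ≤ l) {J n : ℤ} {z w : ℍ} (hz : z ∈ brick l J n)
    (hw : w ∈ brick l J n) : dist z w ≤ 4 * l ^ 4 + l ^ 2 := by
  have hl0 : 0 < l := by linarith
  obtain ⟨z1, z2, z3, z4⟩ := hz
  obtain ⟨w1, w2, w3, w4⟩ := hw
  have hJ : 0 < l ^ (J - 1) := zpow_pos hl0 _
  have e1 : l ^ J = l ^ (J - 1) * l := by rw [← zpow_add_one₀ hl0.ne', sub_add_cancel]
  have e2 : l ^ (J + 1) = l ^ (J - 1) * l ^ 2 := by rw [zpow_add_one₀ hl0.ne', e1]; ring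
  rw [e2] at z2 w2
  rw [e1] at z3 z4 w3 w4
  have hsqrt : l ^ (J - 1) ≤ √(z.im * w.im) := by
    refine Real.le_sqrt_of_sq_le ?_
    rw [sq]
    exact mul_le_mul z1 w1 hJ.le z.im_pos.le
  refine (dist_le_dist_coe_div_sqrt z w).trans ((div_le_iff₀ (hJ.trans_le hsqrt)).2 ?_)
  have h1 : dist (z : ℂ) w ≤ (4 * l ^ 4 + l ^ 2) * l ^ (J - 1) := by
    rw [dist_eq_norm]
    refine (Complex.norm_le_abs_re_add_abs_im _).trans ?_
    change |z.re - w.re| + |z.im - w.im| ≤ _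
    have hsq : 0 ≤ l ^ 2 * (l ^ (J - 1) * l) := by positivity
    have h2 : |z.re - w.re| ≤ 4 * l ^ 4 * l ^ (J - 1) := by
      rw [abs_le]; constructor <;> nlinarith
    have h3 : |z.im - w.im| ≤ l ^ 2 * l ^ (J - 1) := by
      rw [abs_le]; constructor <;> linarith
    linarith
  exact h1.trans (mul_le_mul_of_nonneg_left hsqrt (by positivity))

theorem exists_iterNbhd_diam_le {X : Type*} [MetricSpace X] {𝒴 : Set (Set X)} {B : ℝ}
    (hB : ∀ Y ∈ 𝒴, ∀ x ∈ Y, ∀ y ∈ Y, dist x y ≤ B) (s : ℝ) (m : ℕ) :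
    ∃ D : ℝ, ∀ Y ∈ 𝒴, ∀ x ∈ iterNbhd 𝒴 s m Y, ∀ y ∈ iterNbhd 𝒴 s m Y, dist x y ≤ D := by
  induction m with
  | zero => exact ⟨B, hB⟩
  | succ m ih =>
    obtain ⟨D, hD⟩ := ih
    have key : ∀ Y, ∀ x ∈ iterNbhd 𝒴 s (m + 1) Y, ∃ z ∈ iterNbhd 𝒴 s m Y,
        dist x z ≤ B + s := by
      rintro Y x ⟨Y', ⟨hY', x', hx', z, hz, hxz⟩, hx⟩
      exact ⟨z, hz, by linarith [dist_triangle x x' z, hB Y' hY' x hx x' hx']⟩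
    refine ⟨(B + s) + D + (B + s), fun Y hY x hx y hy => ?_⟩
    obtain ⟨z, hz, hxz⟩ := key Y x hx
    obtain ⟨w, hw, hyw⟩ := key Y y hy
    have h1 := dist_triangle4 x z w y
    rw [dist_comm w y] at h1
    linarith [hD Y hY z hz w hw]

theorem zero_mem_polyFamily (d : ℕ) : (fun _ => 0 : ℝ → ℝ) ∈ polyFamily d :=
  ⟨fun _ _ _ _ _ => le_rfl, fun _ => le_rfl, 1, one_pos, fun r hr => by positivity⟩

theorem fGrowing_iterNbhd_of_bounded {X : Type*} [MetricSpace X] (hX : BddGeom X)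
    {𝒴 : Set (Set X)} {B : ℝ} (hB : ∀ Y ∈ 𝒴, ∀ x ∈ Y, ∀ y ∈ Y, dist x y ≤ B) (d : ℕ) (s : ℝ)
    (m : ℕ) : FGrowing (polyFamily d) (iterNbhd 𝒴 s m '' 𝒴) := by
  obtain ⟨D, hD⟩ := exists_iterNbhd_diam_le hB s m
  obtain ⟨N, hN⟩ := hX D
  refine ⟨_, zero_mem_polyFamily d, max 1 N, le_max_left _ _, ?_⟩
  rintro _ ⟨Y, hY, rfl⟩ x r _ t ht
  rw [mul_zero, zero_add]
  refine le_trans ?_ (le_max_right _ _)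
  rcases t.eq_empty_or_nonempty with rfl | ⟨y, hy⟩
  · simp
  · have := hN y t fun z hz => hD Y hY z (ht hz).1 y (ht (Finset.mem_coe.2 hy)).1
    exact_mod_cast this

theorem ovAsdimLE_two {X : Set ℍ} (hsep : ∀ x ∈ X, ∀ y ∈ X, x ≠ y → 1 ≤ dist x y) (d : ℕ) :
    OvAsdimLE (polyFamily d) X 2 := by
  intro r _
  obtain ⟨h, hh⟩ := exists_nat_gt (Real.exp r)
  have hh1 : (1 : ℤ) ≤ h := by
    have : (0 : ℝ) < h := (Real.exp_pos r).trans hh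
    exact_mod_cast this
  set l : ℝ := 2 * ((h : ℤ) : ℝ) with hl
  have hl1 : 1 ≤ l := by
    have : (1 : ℝ) ≤ ((h : ℤ) : ℝ) := by exact_mod_cast hh1
    linarith
  have hlr : Real.exp r ≤ l := by
    rw [hl]; push_cast; linarith [Real.exp_pos r]
  refine ⟨fun i => {A | ∃ J n : ℤ, J % 3 = (i : ℕ) ∧ A = (↑) ⁻¹' brick l J n},
    ⟨fun x => ?_, fun i => ?_⟩, fun s _ m =>
    fGrowing_iterNbhd_of_bounded (B := 4 * l ^ 4 + l ^ 2) (bddGeom_of_separated hsep) ?_ d s m⟩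
  · obtain ⟨J, n, hx⟩ := exists_mem_brick hh1 (x : ℍ)
    exact ⟨⟨(J % 3).toNat, by omega⟩, _, ⟨J, n, by simp only; omega, rfl⟩, hx⟩
  · rintro _ ⟨J, n, hJ, rfl⟩ _ ⟨J', n', hJ', rfl⟩ hne x hx y hy
    rcases lt_trichotomy J J' with h | rfl | h
    · exact le_dist_brick_level hl1 hlr (by omega) hx hy
    · rcases lt_trichotomy n n' with h | rfl | h
      · exact le_dist_brick_row hl1 hlr h hx hy
      · exact absurd rfl hne
      · rw [dist_comm]; exact le_dist_brick_row hl1 hlr h hy hx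
    · rw [dist_comm]; exact le_dist_brick_level hl1 hlr (by omega) hy hx
  · intro Y hY x hx y hy
    obtain ⟨i, J, n, -, rfl⟩ := mem_iUnion.1 hY
    exact dist_le_of_mem_brick hl1 hx hy

end

/-- For a maximal 1-separated subset `X` of the hyperbolic plane and every
`d ∈ ℕ`, `ov-asdim_{poly(d)}(X) = 2`; in particular, for some `r > 0`, every two-coloured
decomposition into `r`-separated pieces has, for some `s ≥ 1` and `m`, iterated
neighbourhoods whose growth fails every uniform polynomial bound of degree `d`. -/
theorem ov_asdim_polyd_hyperbolic_plane_eq_two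
    (X : Set UpperHalfPlane)
    (hsep : ∀ x ∈ X, ∀ y ∈ X, x ≠ y → 1 ≤ dist x y)
    (hmax : ∀ z : UpperHalfPlane, ∃ x ∈ X, dist z x ≤ 1)
    (d : ℕ) :
    OvAsdimLE (polyFamily d) ↥X 2 ∧
    (∃ r : ℝ, 0 < r ∧ ∀ 𝒰 : Fin 2 → Set (Set ↥X), Decomp 1 r 𝒰 →
      ∃ (s : ℝ) (m : ℕ), 1 ≤ s ∧ ∀ C : ℝ, 1 ≤ C →
        ∃ Y ∈ ⋃ i, 𝒰 i, ∃ (x : ↥X) (R : ℝ), 0 ≤ R ∧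
          ∃ t : Finset ↥X, ↑t ⊆ iterNbhd (⋃ i, 𝒰 i) s m Y ∩ Metric.closedBall x R ∧
            C * R ^ d + C < (t.card : ℝ)) := by
  choose near hnear hdist using hmax
  refine ⟨ovAsdimLE_two hsep d, 7, by norm_num, fun 𝒰 hdec => ?_⟩
  by_contra! hno
  refine PolyTwoColouring.elim (d := d) (𝒰 := 𝒰) (ξ := fun p => ⟨near (gridPt p), hnear _⟩)
    ⟨fun z => ⟨near z, hnear z, hdist z⟩, hdec, fun p => hdist _, fun s hs m => ?_⟩
  obtain ⟨C, hC, h⟩ := hno s m hs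
  exact ⟨C, hC, h⟩
end

section
/- Let r > 0 and let U be a subset of the hyperbolic plane ℍ² which is 1-uniformly discrete, r-connected, and of uniformly subexponential growth: there is a non-decreasing function g with (1/R)·log g(R) → 0 as R → ∞ such that |U ∩ B(p, R)| ≤ g(R) for every p ∈ ℍ² and R > 0. Then there exists s (depending only on r and g) such that for every finite sequence x = x₀, x₁, …, x_m = y of points of U with d(x_i, x_{i+1}) ≤ r for all i, and every point p ∈ ℍ² satisfying d(x, p) + d(p, y) = d(x, y) (i.e. p lies on the geodesic from x to y), some x_i satisfies d(x_i, p) ≤ s. -/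
open Metric Set

/-- The Euclidean distance between two points in the Poincaré disc model centred at `p`. -/
theorem UpperHalfPlane.dist_cayley (p z w : UpperHalfPlane) :
    dist (((z : ℂ) - p) / (z - (starRingEnd ℂ) p)) (((w : ℂ) - p) / (w - (starRingEnd ℂ) p)) =
      Real.sinh (dist z w / 2) / (Real.cosh (dist z p / 2) * Real.cosh (dist w p / 2)) := by
  have ne (v : UpperHalfPlane) : (v : ℂ) - (starRingEnd ℂ) p ≠ 0 := by
    intro h
    have h' := congrArg Complex.im h
    simp only [Complex.sub_im, Complex.conj_im, UpperHalfPlane.coe_im, Complex.zero_im] at h'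
    linarith [v.im_pos, p.im_pos]
  have key : ((z : ℂ) - p) / (z - (starRingEnd ℂ) p) - ((w : ℂ) - p) / (w - (starRingEnd ℂ) p) =
      (z - w) * (p - (starRingEnd ℂ) p) / ((z - (starRingEnd ℂ) p) * (w - (starRingEnd ℂ) p)) := by
    have h1 := ne z
    have h2 := ne w
    field_simp
    ring
  have hp : ‖(p : ℂ) - (starRingEnd ℂ) p‖ = 2 * p.im := by
    rw [← Complex.dist_eq, Complex.dist_self_conj, UpperHalfPlane.coe_im, abs_of_pos p.im_pos]
  rw [Complex.dist_eq, key, norm_div, norm_mul, norm_mul, hp, UpperHalfPlane.sinh_half_dist,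
    UpperHalfPlane.cosh_half_dist, UpperHalfPlane.cosh_half_dist, Complex.dist_eq,
    Complex.dist_eq, Complex.dist_eq, Real.sqrt_mul z.im_pos.le, Real.sqrt_mul z.im_pos.le,
    Real.sqrt_mul w.im_pos.le]
  have hz := norm_pos_iff.2 (ne z)
  have hw := norm_pos_iff.2 (ne w)
  have sz := Real.sqrt_pos.2 z.im_pos
  have sw := Real.sqrt_pos.2 w.im_pos
  have sp := Real.sqrt_pos.2 p.im_pos
  have hps := Real.sq_sqrt p.im_pos.le
  field_simp
  rw [hps]

/-- A chain whose steps are controlled by a weight of their starting point moves by at most the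
total weight of the points it visits, each counted once. -/
theorem dist_le_sum_image_of_chain {X Y : Type*} [DecidableEq X] [PseudoMetricSpace Y]
    (f : X → Y) (w : X → ℝ) (hw : ∀ x, 0 ≤ w x) (m : ℕ) : ∀ c : ℕ → X,
    (∀ i < m, dist (f (c i)) (f (c (i + 1))) ≤ w (c i)) →
      dist (f (c 0)) (f (c m)) ≤ ∑ v ∈ (Finset.range (m + 1)).image c, w v := by
  induction m using Nat.strong_induction_on with
  | _ m ih =>
  intro c hc
  by_cases hj : ∃ j, 0 < j ∧ j ≤ m ∧ c j = c 0
  · obtain ⟨j, hj0, hjm, hjc⟩ := hj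
    have h := ih (m - j) (by omega) (fun i => c (i + j)) fun i hi => by
      have := hc (i + j) (by omega)
      rwa [show i + j + 1 = i + 1 + j by omega] at this
    simp only [zero_add, Nat.sub_add_cancel hjm, hjc] at h
    refine h.trans (Finset.sum_le_sum_of_subset_of_nonneg ?_ fun _ _ _ => hw _)
    intro v hv
    simp only [Finset.mem_image, Finset.mem_range] at hv ⊢
    obtain ⟨i, hi, rfl⟩ := hv
    exact ⟨i + j, by omega, rfl⟩
  · rcases Nat.eq_zero_or_pos m with rfl | hm
    · simpa using hw (c 0)
    · have h := ih (m - 1) (by omega) (fun i => c (i + 1)) fun i hi => hc (i + 1) (by omega)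
      simp only [zero_add, Nat.sub_add_cancel hm] at h
      have h0 := hc 0 hm
      have hnot : c 0 ∉ (Finset.range m).image fun i => c (i + 1) := by
        simp only [Finset.mem_image, Finset.mem_range, not_exists, not_and]
        exact fun i hi he => hj ⟨i + 1, by omega, by omega, he⟩
      calc dist (f (c 0)) (f (c m))
          ≤ w (c 0) + ∑ v ∈ (Finset.range m).image fun i => c (i + 1), w v :=
            (dist_triangle _ (f (c (0 + 1))) _).trans (add_le_add h0 h)
        _ = ∑ v ∈ insert (c 0) ((Finset.range m).image fun i => c (i + 1)), w v :=
            (Finset.sum_insert hnot).symm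
        _ ≤ _ := by
            refine Finset.sum_le_sum_of_subset_of_nonneg ?_ fun _ _ _ => hw _
            intro v hv
            simp only [Finset.mem_insert, Finset.mem_image, Finset.mem_range] at hv ⊢
            rcases hv with rfl | ⟨i, hi, rfl⟩
            · exact ⟨0, by omega, rfl⟩
            · exact ⟨i + 1, by omega, rfl⟩

theorem SubexpFun.summable_mul_exp_neg {g : ℝ → ℝ} (hg : SubexpFun g) :
    Summable fun n : ℕ => g (n + 1) * Real.exp (-n) := by
  obtain ⟨-, hnn, hlim⟩ := hg
  have hev : ∀ᶠ R : ℝ in Filter.atTop, g R ≤ Real.exp (R / 2) := by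
    filter_upwards [hlim.eventually_lt_const (show (0 : ℝ) < 1 / 2 by norm_num),
      Filter.eventually_gt_atTop 0] with R h hR
    rw [div_lt_iff₀ hR] at h
    rcases (hnn R).eq_or_lt with h0 | h0
    · rw [← h0]
      positivity
    · rw [← Real.log_le_iff_le_exp h0]
      linarith
  have hev' : ∀ᶠ n : ℕ in Filter.atTop, g (n + 1) ≤ Real.exp (((n : ℝ) + 1) / 2) :=
    (Filter.tendsto_atTop_add_const_right _ 1 tendsto_natCast_atTop_atTop).eventually hev
  have hsum : Summable fun n : ℕ => Real.exp (1 / 2) * Real.exp (n * (-1 / 2 : ℝ)) :=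
    (Real.summable_exp_nat_mul_iff.2 (by norm_num)).mul_left _
  refine Summable.of_norm_bounded_eventually_nat hsum ?_
  filter_upwards [hev'] with n hn
  rw [Real.norm_of_nonneg (mul_nonneg (hnn _) (Real.exp_pos _).le), ← Real.exp_add]
  calc g (n + 1) * Real.exp (-n) ≤ Real.exp (((n : ℝ) + 1) / 2) * Real.exp (-n) := by gcongr
    _ = _ := by
      rw [← Real.exp_add]
      ring_nf

/-- The sum of `exp (-dist v p)` over points `v` far from `p` in a set of subexponential growth
is uniformly small. -/
theorem SubexpFun.exists_sum_exp_neg_dist_lt {X : Type*} [PseudoMetricSpace X] {g : ℝ → ℝ}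
    (hg : SubexpFun g) {ε : ℝ} (hε : 0 < ε) :
    ∃ S : ℝ, ∀ (V : Finset X) (p : X), (∀ v ∈ V, S ≤ dist v p) →
      (∀ R : ℝ, 0 < R → ∀ t ⊆ V, (t : Set X) ⊆ closedBall p R → (t.card : ℝ) ≤ g R) →
        ∑ v ∈ V, Real.exp (-dist v p) < ε := by
  classical
  obtain ⟨F, hF⟩ := summable_iff_vanishing_norm.1 hg.summable_mul_exp_neg ε hε
  refine ⟨(F.sup id : ℕ) + 1, fun V p hV hcard => ?_⟩
  let k : X → ℕ := fun v => ⌊dist v p⌋₊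
  have hdisj : Disjoint (V.image k) F := by
    rw [Finset.disjoint_left]
    intro n hn hnF
    obtain ⟨v, hv, rfl⟩ := Finset.mem_image.1 hn
    have h1 : k v ≤ F.sup id := Finset.le_sup (f := id) hnF
    have h2 : F.sup id + 1 ≤ k v := Nat.le_floor (by exact_mod_cast hV v hv)
    omega
  refine lt_of_le_of_lt ?_ ((le_abs_self _).trans_lt (hF _ hdisj))
  rw [← Finset.sum_fiberwise_of_maps_to (fun v hv => Finset.mem_image_of_mem k hv)]
  refine Finset.sum_le_sum fun n _ => ?_
  calc ∑ v ∈ V with k v = n, Real.exp (-dist v p)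
      ≤ ∑ v ∈ V with k v = n, Real.exp (-(n : ℝ)) := by
        refine Finset.sum_le_sum fun v hv => ?_
        rw [← (Finset.mem_filter.1 hv).2]
        gcongr
        exact Nat.floor_le dist_nonneg
    _ = ((V.filter (k · = n)).card : ℝ) * Real.exp (-(n : ℝ)) := by
        rw [Finset.sum_const, nsmul_eq_mul]
    _ ≤ g (n + 1) * Real.exp (-(n : ℝ)) := by
        gcongr
        refine hcard _ (by positivity) _ (Finset.filter_subset _ _) fun v hv => ?_
        rw [mem_closedBall, ← (Finset.mem_filter.1 hv).2]
        exact (Nat.lt_floor_add_one _).le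

theorem Real.cosh_le_two_mul_sinh {a : ℝ} (ha : 1 ≤ a) : Real.cosh a ≤ 2 * Real.sinh a := by
  have h1 : 2 ≤ Real.exp a := by linarith [Real.add_one_le_exp a]
  have h2 : Real.exp (-a) ≤ 1 := Real.exp_le_one_iff.2 (by linarith)
  rw [Real.cosh_eq, Real.sinh_eq]
  nlinarith [Real.exp_pos (-a), show Real.exp a * Real.exp (-a) = 1 by simp [← Real.exp_add]]

theorem Real.one_le_sinh_add_div_cosh_mul_cosh {a b : ℝ} (ha : 1 ≤ a) (hb : 1 ≤ b) :
    1 ≤ Real.sinh (a + b) / (Real.cosh a * Real.cosh b) := by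
  rw [one_le_div (by positivity), Real.sinh_add]
  nlinarith [Real.cosh_le_two_mul_sinh ha, Real.cosh_le_two_mul_sinh hb, Real.cosh_pos a,
    Real.cosh_pos b]

theorem Real.exp_div_two_le_cosh (a : ℝ) : Real.exp a / 2 ≤ Real.cosh a := by
  rw [Real.cosh_eq]
  linarith [Real.exp_pos (-a)]

theorem UpperHalfPlane.dist_cayley_le {p z w : UpperHalfPlane} {r : ℝ} (hr : 0 ≤ r)
    (h : dist z w ≤ r) :
    dist (((z : ℂ) - p) / (z - (starRingEnd ℂ) p)) (((w : ℂ) - p) / (w - (starRingEnd ℂ) p)) ≤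
      4 * Real.sinh (r / 2) * Real.exp (r / 2) * Real.exp (-dist z p) := by
  have hs : 0 ≤ Real.sinh (r / 2) := Real.sinh_nonneg_iff.2 (by linarith)
  have hw : dist z p - r ≤ dist w p := by linarith [dist_triangle z w p]
  rw [UpperHalfPlane.dist_cayley, div_le_iff₀ (by positivity)]
  calc Real.sinh (dist z w / 2) ≤ Real.sinh (r / 2) := Real.sinh_le_sinh.2 (by linarith)
    _ = 4 * Real.sinh (r / 2) * Real.exp (r / 2) * Real.exp (-dist z p) *
        (Real.exp (dist z p / 2) / 2 * (Real.exp ((dist z p - r) / 2) / 2)) := by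
      have : Real.exp (r / 2) * Real.exp (-dist z p) *
          (Real.exp (dist z p / 2) * Real.exp ((dist z p - r) / 2)) = 1 := by
        rw [← Real.exp_add, ← Real.exp_add, ← Real.exp_add, Real.exp_eq_one_iff]
        ring
      linear_combination -Real.sinh (r / 2) * this
    _ ≤ _ := by
      gcongr
      · exact Real.exp_div_two_le_cosh _
      · exact (Real.exp_div_two_le_cosh _).trans' (by gcongr)

/-- A 1-uniformly discrete, `r`-connected subset of the hyperbolic plane
of uniformly subexponential growth is quasi-convex: discrete chains in `U` pass uniformly
close to every point on the geodesic between their endpoints, with the constant depending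
only on `r` and the growth function `g`. -/
theorem quasiconvexity_of_subexponential_subsets_H2
    (r : ℝ) (hr : 0 < r) (g : ℝ → ℝ) (hg : SubexpFun g) :
    ∃ s : ℝ, ∀ U : Set UpperHalfPlane,
      (∀ x ∈ U, ∀ y ∈ U, x ≠ y → 1 ≤ dist x y) →
      (∀ x ∈ U, ∀ y ∈ U, ∃ (m : ℕ) (c : ℕ → UpperHalfPlane), c 0 = x ∧ c m = y ∧
        (∀ i ≤ m, c i ∈ U) ∧ ∀ i < m, dist (c i) (c (i + 1)) ≤ r) →
      (∀ (p : UpperHalfPlane) (R : ℝ), 0 < R → ∀ t : Finset UpperHalfPlane,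
        ↑t ⊆ U ∩ Metric.closedBall p R → (t.card : ℝ) ≤ g R) →
      ∀ (m : ℕ) (c : ℕ → UpperHalfPlane), (∀ i ≤ m, c i ∈ U) →
        (∀ i < m, dist (c i) (c (i + 1)) ≤ r) →
        ∀ p : UpperHalfPlane, dist (c 0) p + dist p (c m) = dist (c 0) (c m) →
          ∃ i ≤ m, dist (c i) p ≤ s := by
  classical
  set C := 4 * Real.sinh (r / 2) * Real.exp (r / 2)
  have hC : 0 < C := by
    have := Real.sinh_pos_iff.2 (half_pos hr)
    positivity
  obtain ⟨S, hS⟩ := hg.exists_sum_exp_neg_dist_lt (X := UpperHalfPlane) (inv_pos.2 hC)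
  refine ⟨max S 2, fun U _ _ hU m c hcU hc p hp => ?_⟩
  by_contra! hfar
  set f : UpperHalfPlane → ℂ := fun z => ((z : ℂ) - p) / (z - (starRingEnd ℂ) p) with hf
  have hchain : dist (f (c 0)) (f (c m)) ≤
      ∑ v ∈ (Finset.range (m + 1)).image c, C * Real.exp (-dist v p) :=
    dist_le_sum_image_of_chain f _ (fun _ => by positivity) m c fun i hi =>
      UpperHalfPlane.dist_cayley_le hr.le (hc i hi)
  have hsum : ∑ v ∈ (Finset.range (m + 1)).image c, Real.exp (-dist v p) < C⁻¹ := by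
    refine hS _ p (fun v hv => ?_) fun R hR t ht htR => hU p R hR t (subset_inter ?_ htR)
    · obtain ⟨i, hi, rfl⟩ := Finset.mem_image.1 hv
      exact (le_max_left _ _).trans (hfar i (Nat.lt_succ_iff.1 (Finset.mem_range.1 hi))).le
    · intro v hv
      obtain ⟨i, hi, rfl⟩ := Finset.mem_image.1 (ht hv)
      exact hcU i (Nat.lt_succ_iff.1 (Finset.mem_range.1 hi))
  have hends : 1 ≤ dist (f (c 0)) (f (c m)) := by
    have h0 := (le_max_right S 2).trans (hfar 0 m.zero_le).le
    have hm := (le_max_right S 2).trans (hfar m le_rfl).le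
    rw [hf, UpperHalfPlane.dist_cayley, ← hp, dist_comm p, add_div]
    exact Real.one_le_sinh_add_div_cosh_mul_cosh (by linarith) (by linarith)
  rw [← Finset.mul_sum] at hchain
  have : C * ∑ v ∈ (Finset.range (m + 1)).image c, Real.exp (-dist v p) < 1 := by
    calc _ < C * C⁻¹ := by gcongr
      _ = 1 := mul_inv_cancel₀ hC.ne'
  linarith
end
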